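/- arXiv:1412.3945 — 2 statements merged into one kernel-verified Lean document; each statement's English description precedes it below -/
import Mathlib

section
/- For integers a, c ≥ 1, b ≥ 0, 1 ≤ j ≤ a, 1 ≤ k ≤ c, define the rational number F(a,b,c;j,k) := [∏_{i=0}^{a−1} (c+i)_b/(1+i)_b] · 3F2[−a+j, b, −c+k; 1−a−c, 1+b; 1] · (1+b)_{a−j} (j)_{k−1} (1+c−k)_{k−1} / [(1)_{a−j} (1)_{k−1} (1+b+c−k)_{k−1}]. Then for all integers a, c ≥ 2, b ≥ 1, 1 ≤ j ≤ a−1, 1 ≤ k ≤ c−1, the identity F(a,b,c;j,k) · F(a−1,b,c−1;j,k) = F(a,b,c−1;j,k) · F(a−1,b,c;j,k) + F(a−1,b+1,c−1;j,k) · F(a,b−1,c;j,k) holds. -/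
/-- The rising factorial (Pochhammer symbol) `(x)_n = x (x+1) ⋯ (x+n-1)`. -/
def rF (x : ℚ) (n : ℕ) : ℚ := ∏ t ∈ Finset.range n, (x + t)

/-- The hypergeometric series `pFq[tops; bots; 1] = Σ_{t ≥ 0} ∏(aᵢ)_t / (∏(bᵢ)_t · t!)`. -/
noncomputable def hyp (tops bots : List ℚ) : ℚ :=
  ∑' t : ℕ, (tops.map (fun p => rF p t)).prod /
    ((bots.map (fun p => rF p t)).prod * (Nat.factorial t : ℚ))

/-- The rational number `F(a,b,c;j,k)` of Proposition 3.1. -/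
noncomputable def Ffun (a b c j k : ℕ) : ℚ :=
  (∏ i ∈ Finset.range a, rF ((c : ℚ) + i) b / rF (1 + (i : ℚ)) b) *
  hyp [-(a : ℚ) + j, (b : ℚ), -(c : ℚ) + k] [1 - (a : ℚ) - c, 1 + (b : ℚ)] *
  (rF (1 + (b : ℚ)) (a - j) * rF (j : ℚ) (k - 1) * rF (1 + (c : ℚ) - k) (k - 1)) /
  (rF 1 (a - j) * rF 1 (k - 1) * rF (1 + (b : ℚ) + c - k) (k - 1))

theorem rF_zero (x : ℚ) : rF x 0 = 1 := by simp [rF]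

theorem rF_succ (x : ℚ) (n : ℕ) : rF x (n + 1) = rF x n * (x + n) := by
  simp [rF, Finset.prod_range_succ]

theorem rF_shift (x : ℚ) (n : ℕ) : x * rF (x + 1) n = rF x n * (x + n) := by
  induction n with
  | zero => simp [rF_zero]
  | succ n ih =>
    rw [rF_succ, rF_succ, ← ih]
    push_cast
    ring

theorem rF_pos {x : ℚ} (hx : 0 < x) (n : ℕ) : 0 < rF x n :=
  Finset.prod_pos fun t _ => by positivity

theorem rF_neg_natCast_eq_zero {A t : ℕ} (h : A < t) : rF (-(A : ℚ)) t = 0 :=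
  Finset.prod_eq_zero (Finset.mem_range.2 h) (by simp)

/-- The summand of the Gauss series `2F1[-A, -C; 1-A-C-s; 1]`. -/
noncomputable def gaussTerm (A C : ℕ) (s : ℚ) (t : ℕ) : ℚ :=
  rF (-(A : ℚ)) t * rF (-(C : ℚ)) t / (rF (1 - (A : ℚ) - C - s) t * (Nat.factorial t : ℚ))

/-- The Gauss series `2F1[-A, -C; 1-A-C-s; 1]`. -/
noncomputable def gaussSeries (A C : ℕ) (s : ℚ) : ℚ :=
  ∑ t ∈ Finset.range (A + 1), gaussTerm A C s t

/-- The series `3F2[-A, b, -C; 1-A-C-s, 1+b; 1]`. -/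
noncomputable def clausenSum (A C : ℕ) (s b : ℚ) : ℚ :=
  hyp [-(A : ℚ), b, -(C : ℚ)] [1 - (A : ℚ) - C - s, 1 + b]

theorem gaussTerm_comm (A C : ℕ) (s : ℚ) (t : ℕ) : gaussTerm A C s t = gaussTerm C A s t := by
  unfold gaussTerm
  rw [mul_comm (rF (-(A : ℚ)) t), sub_right_comm (1 : ℚ)]

theorem gaussTerm_eq_zero {A C t : ℕ} (s : ℚ) (h : A < t) : gaussTerm A C s t = 0 := by
  simp [gaussTerm, rF_neg_natCast_eq_zero h]

theorem sum_gaussTerm_mul_range (A C : ℕ) (s : ℚ) (f : ℕ → ℚ) {M N : ℕ} (hM : A < M) (hN : A < N) :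
    ∑ t ∈ Finset.range M, gaussTerm A C s t * f t =
      ∑ t ∈ Finset.range N, gaussTerm A C s t * f t := by
  have key : ∀ {N : ℕ}, A < N → ∑ t ∈ Finset.range (A + 1), gaussTerm A C s t * f t =
      ∑ t ∈ Finset.range N, gaussTerm A C s t * f t := fun {N} hN => by
    refine Finset.sum_subset (Finset.range_subset_range.2 hN) fun t _ ht => ?_
    rw [gaussTerm_eq_zero s (by simpa using ht), zero_mul]
  rw [← key hM, ← key hN]

theorem gaussSeries_eq (A C : ℕ) (s : ℚ) {N : ℕ} (hN : A < N) :
    gaussSeries A C s = ∑ t ∈ Finset.range N, gaussTerm A C s t := by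
  simpa [gaussSeries] using sum_gaussTerm_mul_range A C s (fun _ => 1) A.lt_succ_self hN

theorem gaussSeries_comm (A C : ℕ) (s : ℚ) : gaussSeries A C s = gaussSeries C A s := by
  rw [gaussSeries_eq A C s (N := A + C + 1) (by lia), gaussSeries_eq C A s (N := A + C + 1) (by lia)]
  exact Finset.sum_congr rfl fun t _ => gaussTerm_comm A C s t

theorem clausenSum_comm (A C : ℕ) (s b : ℚ) : clausenSum A C s b = clausenSum C A s b := by
  unfold clausenSum hyp
  simp only [List.map_cons, List.map_nil, List.prod_cons, List.prod_nil]
  refine tsum_congr fun t => ?_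
  rw [sub_right_comm (1 : ℚ) A C]
  ring

theorem clausenSum_eq (A C : ℕ) (s b : ℚ) {N : ℕ} (hN : A < N) :
    clausenSum A C s b =
      ∑ t ∈ Finset.range N, gaussTerm A C s t * (rF b t / rF (1 + b) t) := by
  have h : ∀ t, ([-(A : ℚ), b, -(C : ℚ)].map (fun p => rF p t)).prod /
      (([1 - (A : ℚ) - C - s, 1 + b].map (fun p => rF p t)).prod * (Nat.factorial t : ℚ)) =
      gaussTerm A C s t * (rF b t / rF (1 + b) t) := fun t => by
    simp only [List.map_cons, List.map_nil, List.prod_cons, List.prod_nil, gaussTerm]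
    rw [div_mul_div_comm]
    ring
  unfold clausenSum hyp
  simp only [h]
  refine tsum_eq_sum fun t ht => ?_
  rw [gaussTerm_eq_zero s (by simp at ht; lia), zero_mul]

theorem rF_ratio_mul {b : ℚ} (hb : 0 ≤ b) (t : ℕ) : rF b t / rF (1 + b) t * (b + t) = b := by
  have h := rF_shift b t
  have := (rF_pos (x := 1 + b) (by linarith) t).ne'
  rw [add_comm b 1] at h
  field_simp
  linarith

theorem gaussTerm_denom_ne_zero {A C t : ℕ} {s : ℚ} (hs : 0 < s) (h : t ≤ A ∨ t ≤ C) :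
    rF (1 - (A : ℚ) - C - s) t ≠ 0 := by
  refine Finset.prod_ne_zero_iff.2 fun i hi => ?_
  have hi : i + 1 ≤ t := Finset.mem_range.1 hi
  have : (i : ℚ) + 1 ≤ A + C := by exact_mod_cast (by lia : i + 1 ≤ A + C)
  exact ne_of_lt (by linarith)

theorem gaussTerm_succ (A C : ℕ) {s : ℚ} (hs : 0 < s) (t : ℕ) :
    (t + 1) * (1 - A - C - s + t) * gaussTerm A C s (t + 1) =
      (t - A) * (t - C) * gaussTerm A C s t := by
  rcases lt_or_ge t A with h | h
  · have h1 := gaussTerm_denom_ne_zero (C := C) hs (Or.inl (Nat.succ_le_of_lt h))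
    unfold gaussTerm
    rw [Nat.factorial_succ]
    rw [rF_succ] at *
    rw [rF_succ, rF_succ]
    have h2 := left_ne_zero_of_mul h1
    have h3 := right_ne_zero_of_mul h1
    have h4 : (Nat.factorial t : ℚ) ≠ 0 := by positivity
    push_cast
    field_simp
    ring
  · rw [gaussTerm_eq_zero s (Nat.lt_succ_of_le h)]
    rcases h.eq_or_lt with rfl | h
    · simp
    · simp [gaussTerm_eq_zero s h]

theorem gaussTerm_succ_left (A C : ℕ) {s : ℚ} (hs : 0 < s) (t : ℕ) :
    (A + C + s) * ((A + 1 - t) * gaussTerm (A + 1) C s t) =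
      (A + 1) * ((A + C + s - t) * gaussTerm A C s t) := by
  rcases le_or_gt t A with h | h
  · have h1 := gaussTerm_denom_ne_zero (C := C) hs (Or.inl h)
    have h2 := gaussTerm_denom_ne_zero (A := A + 1) (C := C) hs (Or.inl (h.trans A.le_succ))
    have h3 := rF_shift (-((A + 1 : ℕ) : ℚ)) t
    have h4 := rF_shift (1 - ((A + 1 : ℕ) : ℚ) - C - s) t
    rw [show -((A + 1 : ℕ) : ℚ) + 1 = -A by push_cast; ring] at h3
    rw [show 1 - ((A + 1 : ℕ) : ℚ) - C - s + 1 = 1 - A - C - s by push_cast; ring] at h4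
    have h5 : (Nat.factorial t : ℚ) ≠ 0 := by positivity
    unfold gaussTerm
    field_simp
    push_cast at h1 h2 h3 h4 ⊢
    linear_combination (A + C + s) * rF (-(C : ℚ)) t * rF (1 - A - C - s) t * h3 -
      (A + 1) * rF (-(C : ℚ)) t * rF (-(A : ℚ)) t * h4
  · rw [gaussTerm_eq_zero s h]
    rcases (Nat.succ_le_of_lt h).eq_or_lt with rfl | h
    · simp
    · simp [gaussTerm_eq_zero s h]

theorem sum_index_mul_gaussTerm (A C : ℕ) {s : ℚ} (hs : 0 < s) {N : ℕ} (hN : A < N) :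
    s * ∑ t ∈ Finset.range N, gaussTerm A C s t * t = -(A * C * gaussSeries A C s) := by
  have h1 : ∑ t ∈ Finset.range (N + 1), gaussTerm A C s t * (t * (t - A - C - s)) =
      ∑ t ∈ Finset.range N, gaussTerm A C s t * ((t - A) * (t - C)) := by
    rw [Finset.sum_range_succ']
    simp only [Nat.cast_zero, zero_mul, mul_zero, add_zero]
    refine Finset.sum_congr rfl fun t _ => ?_
    have := gaussTerm_succ A C hs t
    push_cast
    linear_combination this
  rw [sum_gaussTerm_mul_range A C s _ (by lia : A < N + 1) hN, ← sub_eq_zero,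
    ← Finset.sum_sub_distrib] at h1
  rw [gaussSeries_eq A C s hN, ← add_eq_zero_iff_eq_neg, Finset.mul_sum, Finset.mul_sum,
    ← Finset.sum_add_distrib, ← neg_eq_zero, ← Finset.sum_neg_distrib, ← h1]
  exact Finset.sum_congr rfl fun t _ => by ring

/-- The Chu–Vandermonde evaluation, as a recurrence. -/
theorem gaussSeries_succ_left (A C : ℕ) {s : ℚ} (hs : 0 < s) :
    (A + C + s) * gaussSeries (A + 1) C s = (s + A) * gaussSeries A C s := by
  have h := Finset.sum_congr (rfl : Finset.range (A + 2) = _)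
    fun t _ => gaussTerm_succ_left A C hs t
  have e1 := sum_index_mul_gaussTerm (A + 1) C hs (N := A + 2) (by lia)
  have e2 := sum_index_mul_gaussTerm A C hs (N := A + 2) (by lia)
  have g1 := gaussSeries_eq (A + 1) C s (N := A + 2) (by lia)
  have g2 := gaussSeries_eq A C s (N := A + 2) (by lia)
  have h' : (A + C + s) * ((A + 1) * gaussSeries (A + 1) C s -
        ∑ t ∈ Finset.range (A + 2), gaussTerm (A + 1) C s t * t) =
      (A + 1) * ((A + C + s) * gaussSeries A C s -
        ∑ t ∈ Finset.range (A + 2), gaussTerm A C s t * t) := by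
    rw [g1, g2]
    simp only [Finset.mul_sum, ← Finset.sum_sub_distrib] at h ⊢
    convert h using 2 <;> ring
  have hne : ((A : ℚ) + 1) * (s + C) ≠ 0 := by positivity
  refine mul_left_cancel₀ hne ?_
  push_cast at e1 e2
  linear_combination s * h' + (A + C + s) * e1 - (A + 1) * e2

theorem clausenSum_succ_left (A C : ℕ) {s b : ℚ} (hs : 0 < s) (hb : 0 ≤ b) :
    (A + C + s) * (A + 1 + b) * clausenSum (A + 1) C s b =
      (A + 1) * (A + C + s + b) * clausenSum A C s b + b * (s - 1) * gaussSeries A C s := by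
  have hG := gaussSeries_succ_left A C hs
  have key : (A + C + s) * ((A + 1 + b) * clausenSum (A + 1) C s b - b * gaussSeries (A + 1) C s) =
      (A + 1) * ((A + C + s + b) * clausenSum A C s b - b * gaussSeries A C s) := by
    rw [clausenSum_eq (A + 1) C s b (N := A + 2) (by lia),
      clausenSum_eq A C s b (N := A + 2) (by lia),
      gaussSeries_eq (A + 1) C s (N := A + 2) (by lia), gaussSeries_eq A C s (N := A + 2) (by lia)]
    simp only [Finset.mul_sum, ← Finset.sum_sub_distrib]
    refine Finset.sum_congr rfl fun t _ => ?_
    have h1 := gaussTerm_succ_left A C hs t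
    have h2 := rF_ratio_mul hb t
    linear_combination rF b t / rF (1 + b) t * h1 +
      ((A + C + s) * gaussTerm (A + 1) C s t - (A + 1) * gaussTerm A C s t) * h2
  linear_combination key + b * hG

theorem clausenSum_succ_right (A C : ℕ) {s b : ℚ} (hs : 0 < s) (hb : 0 ≤ b) :
    (A + C + s) * (C + 1 + b) * clausenSum A (C + 1) s b =
      (C + 1) * (A + C + s + b) * clausenSum A C s b + b * (s - 1) * gaussSeries A C s := by
  rw [clausenSum_comm A (C + 1), clausenSum_comm A C, gaussSeries_comm A C, add_comm (A : ℚ) C]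
  exact clausenSum_succ_left C A hs hb

theorem gaussSeries_succ_right (A C : ℕ) {s : ℚ} (hs : 0 < s) :
    (A + C + s) * gaussSeries A (C + 1) s = (s + C) * gaussSeries A C s := by
  rw [gaussSeries_comm A (C + 1), gaussSeries_comm A C, add_comm (A : ℚ) C]
  exact gaussSeries_succ_left C A hs

theorem clausenSum_add_one (A C : ℕ) {s b : ℚ} (hs : 0 < s) (hb : 0 ≤ b) :
    (b + 1) * (A + C + s + b) * clausenSum A C s b =
      (b + 1 + A) * (b + 1 + C) * clausenSum A C s (b + 1) +
        (b + 1) * (s - 1) * gaussSeries A C s := by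
  have shift : ∑ t ∈ Finset.range (A + 2), gaussTerm A C s t *
        (t - A - C - s - b + (A + C + s + b) * (rF b t / rF (1 + b) t)) =
      ∑ t ∈ Finset.range (A + 1), gaussTerm A C s t * ((t - A) * (t - C) / (b + 1 + t)) := by
    rw [Finset.sum_range_succ']
    have h0 : gaussTerm A C s 0 * (((0 : ℕ) : ℚ) - A - C - s - b +
        (A + C + s + b) * (rF b 0 / rF (1 + b) 0)) = 0 := by
      simp only [rF_zero]
      push_cast
      ring
    rw [h0, add_zero]
    refine Finset.sum_congr rfl fun t _ => ?_
    have h1 := gaussTerm_succ A C hs t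
    have h2 := rF_ratio_mul hb (t + 1)
    have hpos : (b + 1 + t) ≠ 0 := by positivity
    have h3 : rF b (t + 1) / rF (1 + b) (t + 1) = b / (b + 1 + t) := by
      rw [eq_div_iff hpos]
      push_cast at h2
      linear_combination h2
    rw [h3]
    push_cast
    field_simp
    linear_combination h1
  rw [sum_gaussTerm_mul_range A C s _ (by lia : A < A + 2) A.lt_succ_self] at shift
  have e1 := clausenSum_eq A C s b A.lt_succ_self
  have e2 := clausenSum_eq A C s (b + 1) A.lt_succ_self
  have e3 := gaussSeries_eq A C s A.lt_succ_self
  rw [e1, e2, e3, ← sub_eq_zero]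
  rw [← sub_eq_zero] at shift
  rw [← mul_zero (b + 1), ← shift]
  simp only [Finset.mul_sum, ← Finset.sum_sub_distrib, ← Finset.sum_add_distrib]
  refine Finset.sum_congr rfl fun t _ => ?_
  have hpos : (b + 1 + t) ≠ 0 := by positivity
  have h3 : rF (b + 1) t / rF (1 + (b + 1)) t = (b + 1) / (b + 1 + t) := by
    rw [eq_div_iff hpos, rF_ratio_mul (by linarith)]
  rw [h3]
  field_simp
  ring

theorem clausenSum_bilinear (A C : ℕ) {s b : ℚ} (hs : 0 < s) (hb : 1 ≤ b) :
    (A + C + s + b) * (1 + b) * (clausenSum (A + 1) (C + 1) s b * clausenSum A C s b) =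
      (A + C + s) * (1 + b) * (clausenSum (A + 1) C s b * clausenSum A (C + 1) s b) +
        b ^ 2 * (clausenSum A C s (b + 1) * clausenSum (A + 1) (C + 1) s (b - 1)) := by
  have hb0 : 0 ≤ b := by linarith
  have hbp : 0 < b := by linarith
  have h10 := clausenSum_succ_left A C hs hb0
  have h01 := clausenSum_succ_right A C hs hb0
  have h11 := clausenSum_succ_left A (C + 1) hs hb0
  have hp := clausenSum_add_one A C hs hb0
  have hm := clausenSum_add_one (A + 1) (C + 1) hs (sub_nonneg.2 hb)
  have g01 := gaussSeries_succ_right A C hs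
  have g11 := gaussSeries_succ_left A (C + 1) hs
  push_cast at h11 hm g11
  rw [sub_add_cancel] at hm
  generalize clausenSum (A + 1) (C + 1) s b = S11 at *
  generalize clausenSum (A + 1) (C + 1) s (b - 1) = Sm at *
  generalize clausenSum A C s (b + 1) = Sp at *
  generalize clausenSum (A + 1) C s b = S10 at *
  generalize clausenSum A (C + 1) s b = S01 at *
  generalize clausenSum A C s b = S00 at *
  generalize gaussSeries (A + 1) (C + 1) s = G11 at *
  generalize gaussSeries A (C + 1) s = G01 at *
  generalize gaussSeries A C s = G at *
  have hA : (0 : ℚ) ≤ A := by positivity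
  have hC : (0 : ℚ) ≤ C := by positivity
  generalize (A : ℚ) = x at *
  generalize (C : ℚ) = y at *
  have n1 : x + y + s ≠ 0 := by positivity
  have n2 : x + (y + 1) + s ≠ 0 := by positivity
  have n3 : x + 1 + b ≠ 0 := by positivity
  have n4 : y + 1 + b ≠ 0 := by positivity
  have n5 : x + y + s + b + 1 ≠ 0 := by positivity
  have r1 : G01 = (s + y) * G / (x + y + s) := by
    rw [eq_div_iff n1]; linear_combination g01
  have r2 : G11 = (s + x) * G01 / (x + (y + 1) + s) := by
    rw [eq_div_iff n2]; linear_combination g11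
  have r3 : S10 = ((x + 1) * (x + y + s + b) * S00 + b * (s - 1) * G) /
      ((x + y + s) * (x + 1 + b)) := by
    rw [eq_div_iff (mul_ne_zero n1 n3)]; linear_combination h10
  have r4 : S01 = ((y + 1) * (x + y + s + b) * S00 + b * (s - 1) * G) /
      ((x + y + s) * (y + 1 + b)) := by
    rw [eq_div_iff (mul_ne_zero n1 n4)]; linear_combination h01
  have r5 : S11 = ((x + 1) * (x + (y + 1) + s + b) * S01 + b * (s - 1) * G01) /
      ((x + (y + 1) + s) * (x + 1 + b)) := by
    rw [eq_div_iff (mul_ne_zero n2 n3)]; linear_combination h11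
  have r6 : Sp = ((b + 1) * (x + y + s + b) * S00 - (b + 1) * (s - 1) * G) /
      ((x + 1 + b) * (y + 1 + b)) := by
    rw [eq_div_iff (mul_ne_zero n3 n4)]; linear_combination -hp
  have r7 : Sm = ((x + 1 + b) * (y + 1 + b) * S11 + b * (s - 1) * G11) /
      (b * (x + y + s + b + 1)) := by
    rw [eq_div_iff (mul_ne_zero hbp.ne' n5)]; linear_combination hm
  clear h10 h01 h11 hp hm g01 g11
  subst r7 r6 r5 r3 r4 r2 r1
  field_simp
  ring

/-- MacMahon's product, the first factor of `Ffun`. -/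
noncomputable def boxProd (a b c : ℕ) : ℚ :=
  ∏ i ∈ Finset.range a, rF ((c : ℚ) + i) b / rF (1 + (i : ℚ)) b

/-- The factors of `Ffun` other than the hypergeometric series and `boxProd`, in terms of
`A = a - j`, `C = c - k` and `m = k - 1`. -/
noncomputable def pochFactor (A b C j m : ℕ) : ℚ :=
  (rF (1 + (b : ℚ)) A * rF (j : ℚ) m * rF (1 + (C : ℚ)) m) /
  (rF 1 A * rF 1 m * rF (1 + (b : ℚ) + C) m)

theorem Ffun_eq (A b C j m : ℕ) :
    Ffun (A + j) b (C + (m + 1)) j (m + 1) =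
      boxProd (A + j) b (C + (m + 1)) * clausenSum A C (j + m + 1) b * pochFactor A b C j m := by
  unfold Ffun boxProd clausenSum pochFactor
  rw [mul_div_assoc]
  simp only [Nat.add_sub_cancel]
  push_cast
  congr! 3 <;> ring_nf

theorem boxProd_succ_left (a b c : ℕ) :
    boxProd (a + 1) b c = boxProd a b c * (rF ((c : ℚ) + a) b / rF (1 + (a : ℚ)) b) :=
  Finset.prod_range_succ _ _

theorem boxProd_succ_mid (a b c : ℕ) :
    boxProd a (b + 1) c = boxProd a b c * (rF ((c : ℚ) + b) a / rF (1 + (b : ℚ)) a) := by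
  unfold boxProd
  simp only [rF_succ]
  rw [rF, rF, ← Finset.prod_div_distrib, ← Finset.prod_mul_distrib]
  refine Finset.prod_congr rfl fun i _ => ?_
  rw [mul_div_mul_comm, add_right_comm (c : ℚ), add_right_comm (1 : ℚ)]

theorem boxProd_swap_left_right (a b c : ℕ) :
    (a + c + b) * (boxProd (a + 1) b c * boxProd a b (c + 1)) =
      (a + c) * (boxProd (a + 1) b (c + 1) * boxProd a b c) := by
  have h := rF_shift ((c : ℚ) + a) b
  have hn := (rF_pos (x := 1 + (a : ℚ)) (by positivity) b).ne'
  simp only [boxProd_succ_left]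
  push_cast
  rw [add_right_comm (c : ℚ) 1]
  field_simp
  linear_combination -boxProd a b c * boxProd a b (c + 1) * h

theorem boxProd_swap_mid (a b c : ℕ) :
    (a + c + b + 1) * (boxProd a (b + 2) c * boxProd (a + 1) b (c + 1)) =
      (b + 1) * (boxProd (a + 1) (b + 1) (c + 1) * boxProd a (b + 1) c) := by
  rw [boxProd_succ_mid a (b + 1) c, boxProd_succ_mid (a + 1) b (c + 1)]
  have h1 := rF_shift (1 + (b : ℚ)) a
  have n1 := (rF_pos (x := 1 + (b : ℚ)) (by positivity) a).ne'
  have n2 := (rF_pos (x := 1 + (b : ℚ) + 1) (by positivity) a).ne'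
  have n3 : (1 + (b : ℚ) + a) ≠ 0 := by positivity
  rw [rF_succ, rF_succ]
  push_cast
  rw [← add_assoc (1 : ℚ), add_right_comm (1 : ℚ) b 1] at *
  rw [← add_assoc (c : ℚ), add_right_comm (c : ℚ) b 1]
  rw [add_right_comm (1 : ℚ) 1 b] at *
  field_simp
  linear_combination -(boxProd a (b + 1) c * rF ((c : ℚ) + 1 + b) a * boxProd (a + 1) b (c + 1) *
    (c + 1 + b + a)) * h1

theorem pochFactor_swap_left_right (A b C j m : ℕ) :
    pochFactor (A + 1) b C j m * pochFactor A b (C + 1) j m =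
      pochFactor (A + 1) b (C + 1) j m * pochFactor A b C j m := by
  unfold pochFactor
  ring

theorem pochFactor_swap_mid (A b C j m : ℕ) :
    (b + 2) * (pochFactor A (b + 2) C j m * pochFactor (A + 1) b (C + 1) j m) =
      (b + 1) * (pochFactor (A + 1) (b + 1) (C + 1) j m * pochFactor A (b + 1) C j m) := by
  unfold pochFactor
  have h1 := rF_shift (1 + (b : ℚ)) A
  have h2 := rF_shift (2 + (b : ℚ)) A
  push_cast
  simp only [rF_succ (_ + _)]
  rw [show (1 : ℚ) + (b + 2) = 3 + b by ring, show (1 : ℚ) + (b + 1) = 2 + b by ring,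
    show (3 : ℚ) + b + C = 2 + b + (C + 1) by ring,
    show (2 : ℚ) + b + C = 1 + b + (C + 1) by ring]
  rw [show (1 : ℚ) + b + 1 = 2 + b by ring] at h1
  rw [show (2 : ℚ) + b + 1 = 3 + b by ring] at h2
  have n1 := (rF_pos (x := 1) (by positivity) A).ne'
  have n2 := (rF_pos (x := 1) (by positivity) (A + 1)).ne'
  have n3 := (rF_pos (x := 1) (by positivity) m).ne'
  have n4 := (rF_pos (x := 2 + (b : ℚ) + (C + 1)) (by positivity) m).ne'
  have n5 := (rF_pos (x := 1 + (b : ℚ) + (C + 1)) (by positivity) m).ne'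
  field_simp
  linear_combination rF (j : ℚ) m ^ 2 * rF (1 + (C : ℚ)) m * rF (1 + ((C : ℚ) + 1)) m *
    (rF (1 + (b : ℚ)) A * (1 + b + A) * h2 - rF (2 + (b : ℚ)) A * (2 + b + A) * h1)

/-- The recurrence satisfied by `F(a,b,c;j,k)`. -/
theorem Ffun_recurrence (a b c j k : ℕ) (ha : 2 ≤ a) (hb : 1 ≤ b) (hc : 2 ≤ c)
    (hj1 : 1 ≤ j) (hj2 : j ≤ a - 1) (hk1 : 1 ≤ k) (hk2 : k ≤ c - 1) :
    Ffun a b c j k * Ffun (a - 1) b (c - 1) j k =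
      Ffun a b (c - 1) j k * Ffun (a - 1) b c j k +
        Ffun (a - 1) (b + 1) (c - 1) j k * Ffun a (b - 1) c j k := by
  obtain ⟨m, rfl⟩ : ∃ m, k = m + 1 := ⟨k - 1, by lia⟩
  obtain ⟨A, rfl⟩ : ∃ A, a = A + 1 + j := ⟨a - 1 - j, by lia⟩
  obtain ⟨C, rfl⟩ : ∃ C, c = C + 1 + (m + 1) := ⟨c - 1 - (m + 1), by lia⟩
  obtain ⟨b, rfl⟩ : ∃ b', b = b' + 1 := ⟨b - 1, by lia⟩
  rw [show A + 1 + j - 1 = A + j by lia, show C + 1 + (m + 1) - 1 = C + (m + 1) by lia,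
    Nat.add_sub_cancel]
  simp only [Ffun_eq]
  have hS := clausenSum_bilinear A C (s := j + m + 1) (b := ((b + 1 : ℕ) : ℚ)) (by positivity)
    (by push_cast; linarith [(Nat.cast_nonneg b : (0 : ℚ) ≤ b)])
  have hP1 := boxProd_swap_left_right (A + j) (b + 1) (C + (m + 1))
  have hP2 := boxProd_swap_mid (A + j) b (C + (m + 1))
  have hR1 := pochFactor_swap_left_right A (b + 1) C j m
  have hR2 := pochFactor_swap_mid A b C j m
  rw [show A + 1 + j = A + j + 1 by ring, show C + 1 + (m + 1) = C + (m + 1) + 1 by ring]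
  push_cast at hS hP1 hP2 ⊢
  rw [add_sub_cancel_right] at hS
  have hn : ((A : ℚ) + C + (j + m + 1) + (b + 1)) * (b + 2) ≠ 0 := by positivity
  refine mul_left_cancel₀ hn ?_
  rw [show b + 1 + 1 = b + 2 from rfl]
  generalize boxProd (A + j + 1) (b + 1) (C + (m + 1) + 1) = B11 at *
  generalize boxProd (A + j) (b + 1) (C + (m + 1)) = B00 at *
  generalize boxProd (A + j + 1) (b + 1) (C + (m + 1)) = B10 at *
  generalize boxProd (A + j) (b + 1) (C + (m + 1) + 1) = B01 at *
  generalize boxProd (A + j) (b + 2) (C + (m + 1)) = Bp at *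
  generalize boxProd (A + j + 1) b (C + (m + 1) + 1) = Bm at *
  generalize pochFactor (A + 1) (b + 1) (C + 1) j m = R11 at *
  generalize pochFactor A (b + 1) C j m = R00 at *
  generalize pochFactor (A + 1) (b + 1) C j m = R10 at *
  generalize pochFactor A (b + 1) (C + 1) j m = R01 at *
  generalize pochFactor A (b + 2) C j m = Rp at *
  generalize pochFactor (A + 1) b (C + 1) j m = Rm at *
  generalize clausenSum (A + 1) (C + 1) _ ((b : ℚ) + 1) = S11 at *
  generalize clausenSum A C _ ((b : ℚ) + 1) = S00 at *
  generalize clausenSum (A + 1) C _ _ = S10 at *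
  generalize clausenSum A (C + 1) _ _ = S01 at *
  rw [show (b : ℚ) + 1 + 1 = b + 2 by ring] at *
  generalize clausenSum A C _ ((b : ℚ) + 2) = Sp at *
  generalize clausenSum (A + 1) (C + 1) _ (b : ℚ) = Sm at *
  linear_combination B11 * B00 * R11 * R00 * hS - (b + 2) * S10 * S01 * R10 * R01 * hP1 -
    (b + 2) * (A + C + (j + m + 1)) * B11 * B00 * S10 * S01 * hR1 -
    Sp * Sm * (b + 2) * Rp * Rm * hP2 - Sp * Sm * (b + 1) * B11 * B00 * hR2
end

section
/- Let a, b, c, k be nonnegative integers. In every lozenge tiling of H̄^k_{a,b,c}, the lozenges forming the k strips along the southwestern side (emanating from the adjoined triangles γ_1,…,γ_k) are forced, and consequently M(H̄^k_{a,b,c}) equals the number of lozenge tilings of the hexagon with side lengths a, b+k, c, a, b+k, c, namely M(H̄^k_{a,b,c}) = ∏_{i=1}^{a} ∏_{j=1}^{b+k} ∏_{l=1}^{c} (i+j+l−1)/(i+j+l−2). -/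
/-- A unit triangle of the triangular lattice, encoded as `(x, y, ε)` where
`ε = true` means up-pointing and `ε = false` means down-pointing. -/
abbrev Tri : Type := ℤ × ℤ × Bool

/-- Two unit triangles are adjacent (i.e. together they form a lozenge) iff one of them is
the up-triangle at `(x,y)` and the other is one of the down-triangles at
`(x,y)`, `(x-1,y)`, `(x,y-1)`. -/
def Adj (s t : Tri) : Prop :=
  ∃ x y : ℤ,
    ({s, t} : Set Tri) = {(x, y, true), (x, y, false)} ∨
    ({s, t} : Set Tri) = {(x, y, true), (x - 1, y, false)} ∨
    ({s, t} : Set Tri) = {(x, y, true), (x, y - 1, false)}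

/-- `P` is a lozenge tiling of the region `R`: a partition of `R` into pairs of
adjacent unit triangles. -/
def IsLozengeTiling (R : Set Tri) (P : Set (Set Tri)) : Prop :=
  (∀ L ∈ P, ∃ s t : Tri, Adj s t ∧ L = {s, t}) ∧
  (∀ L ∈ P, L ⊆ R) ∧
  (∀ r ∈ R, ∃! L, L ∈ P ∧ r ∈ L)

/-- The number of lozenge tilings of the region `R`. -/
noncomputable def M (R : Set Tri) : ℕ :=
  Nat.card {P : Set (Set Tri) // IsLozengeTiling R P}

/-- The hexagonal region `H^k_{a,b,c}` on the triangular lattice, whose side lengths in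
clockwise order starting from the top side are `a, b+k, c, a+k, b, c+k`.
(Concretely: the unit triangles all of whose vertices `(x,y)` satisfy
`0 ≤ x ≤ a+b+k`, `0 ≤ y ≤ b+c+k`, `b ≤ x+y ≤ a+b+c+k`.) -/
def HexK (a b c k : ℕ) : Set Tri :=
  {t | 0 ≤ t.1 ∧ t.1 ≤ (a : ℤ) + b + k - 1 ∧ 0 ≤ t.2.1 ∧ t.2.1 ≤ (b : ℤ) + c + k - 1 ∧
    (if t.2.2 then (b : ℤ) ≤ t.1 + t.2.1 ∧ t.1 + t.2.1 ≤ (a : ℤ) + b + c + k - 1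
     else (b : ℤ) - 1 ≤ t.1 + t.2.1 ∧ t.1 + t.2.1 ≤ (a : ℤ) + b + c + k - 2)}

/-- The hexagonal region `H_{a,b,c}` whose side lengths in clockwise order starting from
the top side are `a, b, c, a, b, c`. -/
def Hex (a b c : ℕ) : Set Tri := HexK a b c 0

/-- The region `H̄^k_{a,b,c}` obtained from `H^k_{a,b,c}` by adjoining a string of `k`
contiguous down-pointing unit triangles `γ_1, …, γ_k` just below the western end of its
southern (bottom) side. -/
def HexBar (a b c k : ℕ) : Set Tri :=
  HexK a b c k ∪ {t | ∃ x : ℤ, (b : ℤ) ≤ x ∧ x ≤ (b : ℤ) + k - 1 ∧ t = (x, -1, false)}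

/-- The `k` strips of lozenges along the southwestern side of `H̄^k_{a,b,c}` emanating from
the adjoined triangles `γ_1, …, γ_k`: for `0 ≤ s ≤ k-1`, the `s`-th strip consists of the
lozenges `{(b+s-1-t, t, down), (b+s-1-t, t+1, up)}` for `-1 ≤ t ≤ b+s-1`. -/
def ForcedStrips (a b c k : ℕ) : Set (Set Tri) :=
  {L | ∃ s t : ℤ, 0 ≤ s ∧ s ≤ (k : ℤ) - 1 ∧ -1 ≤ t ∧ t ≤ (b : ℤ) + s - 1 ∧
    L = {((b : ℤ) + s - 1 - t, t, false), ((b : ℤ) + s - 1 - t, t + 1, true)}}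

/-- The lozenge formed by the up-triangle at `(x, y)` and the down-triangle at `(u, v)`. -/
def loz (x y u v : ℤ) : Set Tri := {(x, y, true), (u, v, false)}

theorem up_mem_loz {p q x y u v : ℤ} : ((p, q, true) : Tri) ∈ loz x y u v ↔ p = x ∧ q = y := by
  simp [loz]

theorem down_mem_loz {p q x y u v : ℤ} :
    ((p, q, false) : Tri) ∈ loz x y u v ↔ p = u ∧ q = v := by
  simp [loz]

theorem loz_inj {x y u v x' y' u' v' : ℤ} (h : loz x y u v = loz x' y' u' v') :
    x = x' ∧ y = y' ∧ u = u' ∧ v = v' := by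
  have h1 : ((x, y, true) : Tri) ∈ loz x' y' u' v' := h ▸ up_mem_loz.2 ⟨rfl, rfl⟩
  have h2 : ((u, v, false) : Tri) ∈ loz x' y' u' v' := h ▸ down_mem_loz.2 ⟨rfl, rfl⟩
  rw [up_mem_loz] at h1
  rw [down_mem_loz] at h2
  exact ⟨h1.1, h1.2, h2.1, h2.2⟩

/-- `L` is one of the lozenges of the triangular lattice. -/
def IsLoz (L : Set Tri) : Prop :=
  ∃ x y : ℤ, L = loz x y x y ∨ L = loz x y (x - 1) y ∨ L = loz x y x (y - 1)

theorem exists_adj_iff_isLoz {L : Set Tri} : (∃ s t, Adj s t ∧ L = {s, t}) ↔ IsLoz L := by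
  constructor
  · rintro ⟨s, t, ⟨x, y, h⟩, rfl⟩
    exact ⟨x, y, h⟩
  · rintro ⟨x, y, rfl | rfl | rfl⟩
    · exact ⟨_, _, ⟨x, y, Or.inl rfl⟩, rfl⟩
    · exact ⟨_, _, ⟨x, y, Or.inr (Or.inl rfl)⟩, rfl⟩
    · exact ⟨_, _, ⟨x, y, Or.inr (Or.inr rfl)⟩, rfl⟩

theorem IsLoz.nonempty {L : Set Tri} (h : IsLoz L) : L.Nonempty := by
  obtain ⟨x, y, rfl | rfl | rfl⟩ := h <;> exact ⟨(x, y, true), up_mem_loz.2 ⟨rfl, rfl⟩⟩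

namespace IsLozengeTiling

variable {R : Set Tri} {P : Set (Set Tri)}

theorem isLoz (h : IsLozengeTiling R P) {L : Set Tri} (hL : L ∈ P) : IsLoz L :=
  exists_adj_iff_isLoz.1 (h.1 L hL)

theorem eq_of_mem (h : IsLozengeTiling R P) {L L' : Set Tri} (hL : L ∈ P) (hL' : L' ∈ P)
    {t : Tri} (ht : t ∈ L) (ht' : t ∈ L') : L = L' :=
  (h.2.2 t (h.2.1 L hL ht)).unique ⟨hL, ht⟩ ⟨hL', ht'⟩

theorem up_mem (h : IsLozengeTiling R P) {x y u v : ℤ} (hL : loz x y u v ∈ P) :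
    ((x, y, true) : Tri) ∈ R :=
  h.2.1 _ hL (up_mem_loz.2 ⟨rfl, rfl⟩)

theorem down_mem (h : IsLozengeTiling R P) {x y u v : ℤ} (hL : loz x y u v ∈ P) :
    ((u, v, false) : Tri) ∈ R :=
  h.2.1 _ hL (down_mem_loz.2 ⟨rfl, rfl⟩)

theorem down_unique (h : IsLozengeTiling R P) {x y u v x' y' u' v' : ℤ} (hL : loz x y u v ∈ P)
    (hL' : loz x' y' u' v' ∈ P) (hx : x = x') (hy : y = y') : u = u' ∧ v = v' := by
  subst hx hy
  exact (loz_inj (h.eq_of_mem hL hL' (up_mem_loz.2 ⟨rfl, rfl⟩) (up_mem_loz.2 ⟨rfl, rfl⟩))).2.2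

theorem up_unique (h : IsLozengeTiling R P) {x y u v x' y' u' v' : ℤ} (hL : loz x y u v ∈ P)
    (hL' : loz x' y' u' v' ∈ P) (hu : u = u') (hv : v = v') : x = x' ∧ y = y' := by
  subst hu hv
  have := loz_inj (h.eq_of_mem hL hL' (down_mem_loz.2 ⟨rfl, rfl⟩) (down_mem_loz.2 ⟨rfl, rfl⟩))
  exact ⟨this.1, this.2.1⟩

theorem cases_up (h : IsLozengeTiling R P) {x y : ℤ} (hR : ((x, y, true) : Tri) ∈ R) :
    loz x y x y ∈ P ∨ loz x y (x - 1) y ∈ P ∨ loz x y x (y - 1) ∈ P := by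
  obtain ⟨L, ⟨hL, hm⟩, -⟩ := h.2.2 _ hR
  obtain ⟨p, q, rfl | rfl | rfl⟩ := h.isLoz hL <;> obtain ⟨rfl, rfl⟩ := up_mem_loz.1 hm <;> simp [hL]

theorem cases_down (h : IsLozengeTiling R P) {x y : ℤ} (hR : ((x, y, false) : Tri) ∈ R) :
    loz x y x y ∈ P ∨ loz (x + 1) y x y ∈ P ∨ loz x (y + 1) x y ∈ P := by
  obtain ⟨L, ⟨hL, hm⟩, -⟩ := h.2.2 _ hR
  obtain ⟨p, q, rfl | rfl | rfl⟩ := h.isLoz hL <;> obtain ⟨rfl, rfl⟩ := down_mem_loz.1 hm <;>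
    simp [hL]

end IsLozengeTiling

theorem isLozengeTiling_sUnion {F : Set (Set Tri)} (hl : ∀ L ∈ F, IsLoz L)
    (hd : ∀ L ∈ F, ∀ L' ∈ F, ∀ t, t ∈ L → t ∈ L' → L = L') : IsLozengeTiling (⋃₀ F) F := by
  refine ⟨fun L hL => exists_adj_iff_isLoz.2 (hl L hL), fun L hL => Set.subset_sUnion_of_mem hL, ?_⟩
  rintro t ⟨L, hL, ht⟩
  exact ⟨L, ⟨hL, ht⟩, fun L' h' => hd _ h'.1 _ hL t h'.2 ht⟩

/-- Tilings of `R` containing a prescribed family `F` of disjoint lozenges correspond to tilings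
of the region that remains after removing `F`. -/
def tilingsContainingEquiv {R : Set Tri} {F : Set (Set Tri)} (hF : IsLozengeTiling (⋃₀ F) F)
    (hR : ⋃₀ F ⊆ R) :
    {P // IsLozengeTiling R P ∧ F ⊆ P} ≃ {Q // IsLozengeTiling (R \ ⋃₀ F) Q} where
  toFun P := ⟨P.1 \ F, by
    obtain ⟨P, hP, hFP⟩ := P
    refine ⟨fun L hL => hP.1 L hL.1, ?_, ?_⟩
    · rintro L ⟨hL, hLF⟩ t ht
      refine ⟨hP.2.1 L hL ht, ?_⟩
      rintro ⟨L', hL', ht'⟩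
      exact hLF (hP.eq_of_mem hL (hFP hL') ht ht' ▸ hL')
    · rintro t ⟨ht, htF⟩
      obtain ⟨L, ⟨hL, htL⟩, hu⟩ := hP.2.2 t ht
      exact ⟨L, ⟨⟨hL, fun h => htF ⟨L, h, htL⟩⟩, htL⟩, fun L' h' => hu L' ⟨h'.1.1, h'.2⟩⟩⟩
  invFun Q := ⟨Q.1 ∪ F, by
    obtain ⟨Q, hQ⟩ := Q
    refine ⟨⟨?_, ?_, ?_⟩, Set.subset_union_right⟩
    · rintro L (hL | hL)
      exacts [hQ.1 L hL, hF.1 L hL]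
    · rintro L (hL | hL)
      exacts [(hQ.2.1 L hL).trans Set.sdiff_subset, (hF.2.1 L hL).trans hR]
    · intro t ht
      by_cases htF : t ∈ ⋃₀ F
      · obtain ⟨L, ⟨hL, htL⟩, hu⟩ := hF.2.2 t htF
        refine ⟨L, ⟨Or.inr hL, htL⟩, ?_⟩
        rintro L' ⟨hL' | hL', ht'⟩
        exacts [absurd htF (hQ.2.1 L' hL' ht').2, hu L' ⟨hL', ht'⟩]
      · obtain ⟨L, ⟨hL, htL⟩, hu⟩ := hQ.2.2 t ⟨ht, htF⟩
        refine ⟨L, ⟨Or.inl hL, htL⟩, ?_⟩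
        rintro L' ⟨hL' | hL', ht'⟩
        exacts [hu L' ⟨hL', ht'⟩, absurd ⟨L', hL', ht'⟩ htF]⟩
  left_inv P := by
    obtain ⟨P, hP, hFP⟩ := P
    simp [Set.sdiff_union_of_subset hFP]
  right_inv Q := by
    obtain ⟨Q, hQ⟩ := Q
    have hdisj : Disjoint Q F := by
      rw [Set.disjoint_left]
      intro L hL hLF
      obtain ⟨t, ht⟩ := (hQ.isLoz hL).nonempty
      exact (hQ.2.1 L hL ht).2 ⟨L, hLF, ht⟩
    simp [hdisj.sdiff_eq_left]

theorem M_eq_M_diff_of_forced {R : Set Tri} {F : Set (Set Tri)} (hF : IsLozengeTiling (⋃₀ F) F)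
    (hR : ⋃₀ F ⊆ R) (h : ∀ P, IsLozengeTiling R P → F ⊆ P) : M R = M (R \ ⋃₀ F) := by
  unfold M
  rw [← Nat.card_congr (tilingsContainingEquiv hF hR)]
  exact Nat.card_congr (Equiv.subtypeEquivRight fun P => ⟨fun hP => ⟨hP, h P hP⟩, fun hP => hP.1⟩)

theorem loz_congr {x y u v x' y' u' v' : ℤ} (hx : x = x') (hy : y = y') (hu : u = u')
    (hv : v = v') : loz x y u v = loz x' y' u' v' := by
  subst hx hy hu hv
  rfl

theorem mem_forcedStrips {a b c k : ℕ} {L : Set Tri} :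
    L ∈ ForcedStrips a b c k ↔ ∃ s m : ℕ, s < k ∧ m ≤ b + s ∧
      L = loz (b + s - m) m (b + s - m) (m - 1) := by
  constructor
  · rintro ⟨s, t, hs, hs', ht, ht', rfl⟩
    obtain ⟨s, rfl⟩ := Int.eq_ofNat_of_zero_le hs
    obtain ⟨m, hm⟩ := Int.eq_ofNat_of_zero_le (show 0 ≤ t + 1 by omega)
    refine ⟨s, m, by omega, by omega, ?_⟩
    rw [Set.pair_comm]
    exact loz_congr (by omega) (by omega) (by omega) (by omega)
  · rintro ⟨s, m, hs, hm, rfl⟩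
    refine ⟨s, m - 1, by omega, by omega, by omega, by omega, ?_⟩
    rw [Set.pair_comm]
    exact loz_congr (by omega) (by omega) (by omega) (by omega)

theorem forcedStrips_subset {a b c k : ℕ} {P : Set (Set Tri)}
    (hP : IsLozengeTiling (HexBar a b c k) P) : ForcedStrips a b c k ⊆ P := by
  have key : ∀ s : ℕ, s < k → ∀ m : ℕ, m ≤ b + s →
      loz (b + s - m) m (b + s - m) (m - 1) ∈ P := by
    intro s
    induction s using Nat.strong_induction_on with | _ s ihs
    intro hs m
    induction m with
    | zero =>
      intro hm
      rcases hP.cases_down (x := b + s) (y := -1)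
        (Or.inr ⟨b + s, by omega, by omega, rfl⟩) with h | h | h
      · have := hP.up_mem h
        simp [HexBar, HexK] at this
      · have := hP.up_mem h
        simp [HexBar, HexK] at this
      · simpa using h
    | succ m ih =>
      intro hm
      have ih := ih (by omega)
      rcases hP.cases_down (x := b + s - (m + 1)) (y := m)
        (Or.inl (by simp [HexK]; omega)) with h | h | h
      · rcases Nat.eq_zero_or_pos s with rfl | h0
        · have := hP.up_mem h
          simp [HexBar, HexK] at this
          omega
        · have := hP.down_unique h (ihs (s - 1) (by omega) (by omega) m (by omega))
            (by omega) (by omega)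
          omega
      · have := hP.down_unique h ih (by omega) (by omega)
        omega
      · convert h using 1
        exact loz_congr (by push_cast; omega) (by push_cast; omega) (by push_cast; omega)
          (by push_cast; omega)
  intro L hL
  obtain ⟨s, m, hs, hm, rfl⟩ := mem_forcedStrips.1 hL
  exact key s hs m hm

theorem isLozengeTiling_forcedStrips (a b c k : ℕ) :
    IsLozengeTiling (⋃₀ ForcedStrips a b c k) (ForcedStrips a b c k) := by
  apply isLozengeTiling_sUnion
  · intro L hL
    obtain ⟨s, m, -, -, rfl⟩ := mem_forcedStrips.1 hL
    exact ⟨_, _, Or.inr (Or.inr rfl)⟩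
  · intro L hL L' hL' t ht ht'
    obtain ⟨s, m, -, -, rfl⟩ := mem_forcedStrips.1 hL
    obtain ⟨s', m', -, -, rfl⟩ := mem_forcedStrips.1 hL'
    obtain ⟨x, y, ε⟩ := t
    cases ε
    · rw [down_mem_loz] at ht ht'
      exact loz_congr (by omega) (by omega) (by omega) (by omega)
    · rw [up_mem_loz] at ht ht'
      exact loz_congr (by omega) (by omega) (by omega) (by omega)

theorem mem_sUnion_forcedStrips_up {a b c k : ℕ} {x y : ℤ} :
    ((x, y, true) : Tri) ∈ ⋃₀ ForcedStrips a b c k ↔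
      0 ≤ x ∧ 0 ≤ y ∧ b ≤ x + y ∧ x + y < b + k := by
  constructor
  · rintro ⟨L, hL, ht⟩
    obtain ⟨s, m, hs, hm, rfl⟩ := mem_forcedStrips.1 hL
    rw [up_mem_loz] at ht
    omega
  · rintro ⟨hx, hy, h1, h2⟩
    refine ⟨_, mem_forcedStrips.2 ⟨(x + y - b).toNat, y.toNat, by omega, by omega, rfl⟩, ?_⟩
    rw [up_mem_loz]
    omega

theorem mem_sUnion_forcedStrips_down {a b c k : ℕ} {x y : ℤ} :
    ((x, y, false) : Tri) ∈ ⋃₀ ForcedStrips a b c k ↔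
      0 ≤ x ∧ -1 ≤ y ∧ b ≤ x + y + 1 ∧ x + y + 1 < b + k := by
  constructor
  · rintro ⟨L, hL, ht⟩
    obtain ⟨s, m, hs, hm, rfl⟩ := mem_forcedStrips.1 hL
    rw [down_mem_loz] at ht
    omega
  · rintro ⟨hx, hy, h1, h2⟩
    refine ⟨_, mem_forcedStrips.2 ⟨(x + y + 1 - b).toNat, (y + 1).toNat, by omega, by omega, rfl⟩, ?_⟩
    rw [down_mem_loz]
    omega

theorem sUnion_forcedStrips_subset (a b c k : ℕ) : ⋃₀ ForcedStrips a b c k ⊆ HexBar a b c k := by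
  rintro ⟨x, y, ε⟩ h
  cases ε
  · rw [mem_sUnion_forcedStrips_down] at h
    by_cases hy : y = -1
    · exact Or.inr ⟨x, by omega, by omega, by rw [hy]⟩
    · exact Or.inl (by simp [HexK]; omega)
  · rw [mem_sUnion_forcedStrips_up] at h
    exact Or.inl (by simp [HexK]; omega)

theorem hexBar_diff_forcedStrips (a b c k : ℕ) :
    HexBar a b c k \ ⋃₀ ForcedStrips a b c k = Hex a (b + k) c := by
  ext ⟨x, y, ε⟩
  cases ε
  · rw [Set.mem_sdiff, mem_sUnion_forcedStrips_down]
    simp [HexBar, HexK, Hex]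
    omega
  · rw [Set.mem_sdiff, mem_sUnion_forcedStrips_up]
    simp [HexBar, HexK, Hex]
    omega

theorem M_hexBar (a b c k : ℕ) : M (HexBar a b c k) = M (Hex a (b + k) c) := by
  rw [M_eq_M_diff_of_forced (isLozengeTiling_forcedStrips a b c k)
    (sUnion_forcedStrips_subset a b c k) fun _ hP => forcedStrips_subset hP,
    hexBar_diff_forcedStrips]

theorem sum_Ioc_choose (m : ℤ) (j : ℕ) {a b : ℤ} (h : a ≤ b) :
    ∑ t ∈ Finset.Ioc a b, Ring.choose (t + m) j =
      Ring.choose (b + (m + 1)) (j + 1) - Ring.choose (a + (m + 1)) (j + 1) := by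
  induction b, h using Int.leInduction with
  | base => simp
  | succ b hb ih =>
    rw [← Finset.insert_Ioc_right_eq_Ioc_add_one (by omega), Finset.sum_insert (by simp), ih,
      show b + 1 + (m + 1) = (b + (m + 1)) + 1 by ring, Ring.choose_succ_succ,
      show b + 1 + m = b + (m + 1) by ring]
    ring

/-- Summing the determinant over all sequences that interlace `s` adds one more particle. -/
theorem sum_interlacing_det_choose {n : ℕ} (s : Fin (n + 1) → ℤ)
    (hs : ∀ i : Fin n, s i.castSucc ≤ s i.succ) :
    ∑ s' ∈ Fintype.piFinset fun i : Fin n => Finset.Ioc (s i.castSucc) (s i.succ),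
        (Matrix.of fun i j : Fin n => Ring.choose (s' i + (n : ℤ)) (j : ℕ)).det =
      (Matrix.of fun i j : Fin (n + 1) =>
        Ring.choose (s i + ((n + 1 : ℕ) : ℤ)) (j : ℕ)).det := by
  have h1 := (Matrix.detRowAlternating (R := ℤ) (n := Fin n)).toMultilinearMap.map_sum_finset
    (fun (i : Fin n) (t : ℤ) (j : Fin n) => Ring.choose (t + (n : ℤ)) (j : ℕ))
    (fun i : Fin n => Finset.Ioc (s i.castSucc) (s i.succ))
  refine h1.symm.trans ?_
  change Matrix.det (fun i : Fin n => ∑ t ∈ Finset.Ioc (s i.castSucc) (s i.succ),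
    fun j : Fin n => Ring.choose (t + (n : ℤ)) (j : ℕ)) = _
  rw [Matrix.det_eq_of_forall_row_eq_smul_add_pred (fun _ => 1)
    (A := Matrix.of fun i j : Fin (n + 1) => Ring.choose (s i + ((n + 1 : ℕ) : ℤ)) (j : ℕ))
    (B := Matrix.of fun i j : Fin (n + 1) => Fin.cases (Ring.choose (s 0 + ((n + 1 : ℕ) : ℤ)) (j : ℕ))
      (fun i => Ring.choose (s i.succ + ((n + 1 : ℕ) : ℤ)) (j : ℕ) -
        Ring.choose (s i.castSucc + ((n + 1 : ℕ) : ℤ)) (j : ℕ)) i) (by simp) (by simp)]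
  rw [Matrix.det_succ_column_zero, Fin.sum_univ_succ]
  simp only [Matrix.of_apply, Fin.cases_zero, Fin.cases_succ, Fin.val_zero, Ring.choose_zero_right]
  simp
  congr 1
  ext i j
  simp [Finset.sum_apply, sum_Ioc_choose _ _ (hs i)]

theorem det_choose_mul_superFactorial {n : ℕ} (s : Fin n → ℤ) (m : ℤ) :
    (Matrix.of fun i j : Fin n => Ring.choose (s i + m) (j : ℕ)).det *
      ∏ j : Fin n, ((j : ℕ).factorial : ℤ) = ∏ i : Fin n, ∏ j ∈ Finset.Ioi i, (s j - s i) := by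
  rw [← Matrix.det_vandermonde, ← Matrix.det_vandermonde_add s m, mul_comm,
    Matrix.det_eval_matrixOfPolynomials_eq_det_vandermonde (fun i => s i + m)
      (fun j : Fin n => descPochhammer ℤ j) (fun i => descPochhammer_natDegree ℤ i)
      (fun i => monic_descPochhammer ℤ i), ← Matrix.det_mul_row]
  congr 1
  ext i j
  have := Ring.descPochhammer_eq_factorial_smul_choose (s i + m) (j : ℕ)
  rw [← Polynomial.eval_eq_smeval] at this
  simp [this]

theorem prod_val_sub_val (n : ℕ) :
    ∏ i : Fin n, ∏ j ∈ Finset.Ioi i, (((j : ℕ) : ℤ) - (i : ℕ)) =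
      ∏ j : Fin n, ((j : ℕ).factorial : ℤ) := by
  rw [← det_choose_mul_superFactorial (fun i : Fin n => ((i : ℕ) : ℤ)) 0]
  simp only [add_zero, Ring.choose_natCast]
  rw [Matrix.det_of_isLowerTriangular]
  · simp
  · intro i j hij
    simpa using Nat.choose_eq_zero_of_lt (show (i : ℕ) < j from hij)

/-- The positions `-a, …, -1, b, …, b + c - 1`. -/
def splitPos (a b c : ℕ) (i : Fin (a + c)) : ℤ := (i : ℕ) - a + if (i : ℕ) < a then 0 else b

theorem strictMono_splitPos (a b c : ℕ) : StrictMono (splitPos a b c) := by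
  intro i j hij
  have : (i : ℕ) < j := hij
  unfold splitPos
  split_ifs <;> omega

theorem exists_splitPos_eq_iff {a b c : ℕ} {y : ℤ} :
    (∃ i, splitPos a b c i = y) ↔ -a ≤ y ∧ y < 0 ∨ b ≤ y ∧ y < b + c := by
  constructor
  · rintro ⟨i, rfl⟩
    have := i.2
    unfold splitPos
    split_ifs <;> omega
  · rintro (h | h)
    · refine ⟨⟨(y + a).toNat, by omega⟩, ?_⟩
      unfold splitPos
      simp only
      rw [if_pos (by omega)]
      omega
    · refine ⟨⟨(y + a - b).toNat, by omega⟩, ?_⟩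
      unfold splitPos
      simp only
      rw [if_neg (by omega)]
      omega

theorem prod_splitPos_sub (a b c : ℕ) :
    ∏ i, ∏ j ∈ Finset.Ioi i, ((splitPos a b c j : ℚ) - splitPos a b c i) =
      (∏ i : Fin (a + c), ∏ j ∈ Finset.Ioi i, (((j : ℕ) : ℚ) - (i : ℕ))) *
        ∏ i : Fin a, ∏ l : Fin c, (((i : ℕ) : ℚ) + (l : ℕ) + 1 + b) / ((i : ℕ) + (l : ℕ) + 1) := by
  let r : Fin (a + c) → Fin (a + c) → ℚ := fun i j =>
    if (i : ℕ) < a ∧ a ≤ (j : ℕ) then (((j : ℕ) : ℚ) - (i : ℕ) + b) / ((j : ℕ) - (i : ℕ)) else 1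
  have hr : ∏ i, ∏ j ∈ Finset.Ioi i, r i j =
      ∏ i : Fin a, ∏ l : Fin c, (((i : ℕ) : ℚ) + (l : ℕ) + 1 + b) / ((i : ℕ) + (l : ℕ) + 1) := by
    have h1 : ∀ i, ∏ j ∈ Finset.Ioi i, r i j = ∏ j, r i j := fun i => by
      refine Finset.prod_subset (Finset.subset_univ _) fun j _ hj => if_neg ?_
      have : (j : ℕ) ≤ i := by simpa using hj
      omega
    simp only [h1, Fin.prod_univ_add]
    have h2 : ∀ (i : Fin c) (j : Fin (a + c)), r (Fin.natAdd a i) j = 1 := fun i j =>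
      if_neg (by simp)
    have h3 : ∀ (i : Fin a) (j : Fin a), r (Fin.castAdd c i) (Fin.castAdd c j) = 1 := fun i j =>
      if_neg (by simp)
    simp only [h2, h3, Finset.prod_const_one, one_mul, mul_one]
    rw [← Equiv.prod_comp Fin.revPerm]
    refine Finset.prod_congr rfl fun i _ => Finset.prod_congr rfl fun j _ => ?_
    have hi : (((Fin.rev i : Fin a) : ℕ) : ℚ) = a - (i + 1) := by
      rw [Fin.val_rev, Nat.cast_sub (by omega)]
      push_cast
      ring
    simp only [r, Fin.revPerm_apply, Fin.val_castAdd, Fin.val_natAdd]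
    rw [if_pos (by omega), Nat.cast_add, hi]
    congr 1 <;> ring
  rw [← hr, ← Finset.prod_mul_distrib]
  refine Finset.prod_congr rfl fun i _ => ?_
  rw [← Finset.prod_mul_distrib]
  refine Finset.prod_congr rfl fun j hj => ?_
  have hij : (i : ℕ) < j := by simpa using hj
  have h0 : ((j : ℕ) : ℚ) - (i : ℕ) ≠ 0 := sub_ne_zero.2 (by exact_mod_cast hij.ne')
  simp only [r, splitPos]
  split_ifs <;> first | omega | (push_cast; field_simp; ring)

theorem prod_Icc_telescope (x : ℚ) (hx : 0 < x) (b : ℕ) :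
    ∏ j ∈ Finset.Icc 1 b, (x + j) / (x + j - 1) = (x + b) / x := by
  induction b with
  | zero => simp [hx.ne']
  | succ b ih =>
    rw [Finset.prod_Icc_succ_top (by omega), ih]
    push_cast
    have : x + b ≠ 0 := by positivity
    rw [show x + (b + 1) - 1 = x + (b : ℚ) by ring]
    field_simp

theorem prod_Icc_eq_prod_fin (n : ℕ) (f : ℕ → ℚ) :
    ∏ i ∈ Finset.Icc 1 n, f i = ∏ i : Fin n, f (i + 1) := by
  induction n with
  | zero => simp
  | succ n ih => rw [Finset.prod_Icc_succ_top (by omega), ih, Fin.prod_univ_castSucc]; rfl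

theorem macMahon_product_eq (a b c : ℕ) :
    ∏ i ∈ Finset.Icc 1 a, ∏ j ∈ Finset.Icc 1 b, ∏ l ∈ Finset.Icc 1 c,
        ((i : ℚ) + j + l - 1) / ((i : ℚ) + j + l - 2) =
      ∏ i : Fin a, ∏ l : Fin c, (((i : ℕ) : ℚ) + (l : ℕ) + 1 + b) / ((i : ℕ) + (l : ℕ) + 1) := by
  rw [prod_Icc_eq_prod_fin]
  refine Finset.prod_congr rfl fun i _ => ?_
  rw [Finset.prod_comm, prod_Icc_eq_prod_fin]
  refine Finset.prod_congr rfl fun l _ => ?_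
  rw [← prod_Icc_telescope _ (by positivity)]
  refine Finset.prod_congr rfl fun j _ => ?_
  push_cast
  congr 1 <;> ring

theorem det_choose_splitPos (a b c : ℕ) (m : ℤ) :
    (((Matrix.of fun i j : Fin (a + c) =>
        Ring.choose (splitPos a b c i + m) (j : ℕ)).det : ℤ) : ℚ) =
      ∏ i ∈ Finset.Icc 1 a, ∏ j ∈ Finset.Icc 1 b, ∏ l ∈ Finset.Icc 1 c,
        ((i : ℚ) + j + l - 1) / ((i : ℚ) + j + l - 2) := by
  have h1 := congrArg (Int.cast (R := ℚ)) (det_choose_mul_superFactorial (splitPos a b c) m)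
  have h2 := congrArg (Int.cast (R := ℚ)) (prod_val_sub_val (a + c))
  have h3 : ∏ j : Fin (a + c), ((j : ℕ).factorial : ℚ) ≠ 0 :=
    Finset.prod_ne_zero_iff.2 fun j _ => by positivity
  simp only [Int.cast_mul, Int.cast_prod, Int.cast_sub, Int.cast_natCast] at h1 h2
  rw [prod_splitPos_sub, h2, mul_comm] at h1
  rw [macMahon_product_eq]
  exact mul_left_cancel₀ h3 h1

/-- `s'` interlaces `s`. -/
def Interlaces {n : ℕ} (s : Fin (n + 1) → ℤ) (s' : Fin n → ℤ) : Prop :=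
  ∀ i : Fin n, s i.castSucc < s' i ∧ s' i ≤ s i.succ

/-- In a row with holes `s` below and particles `s'` above, the up-triangle at position `j`
is paired with its left neighbour. -/
def PairedLeft {n : ℕ} (s : Fin (n + 1) → ℤ) (s' : Fin n → ℤ) (j : ℤ) : Prop :=
  j ≤ s 0 ∨ ∃ i : Fin n, s' i < j ∧ j ≤ s i.succ

/-- In a row with holes `s` below and particles `s'` above, the up-triangle at position `j`
is paired with its right neighbour. -/
def PairedRight {n : ℕ} (s : Fin (n + 1) → ℤ) (s' : Fin n → ℤ) (j : ℤ) : Prop :=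
  s (Fin.last n) < j ∨ ∃ i : Fin n, s i.castSucc < j ∧ j < s' i

theorem exists_between_or {n : ℕ} (s : Fin (n + 1) → ℤ) (j : ℤ) :
    j ≤ s 0 ∨ (∃ i : Fin n, s i.castSucc < j ∧ j ≤ s i.succ) ∨ s (Fin.last n) < j := by
  induction n with
  | zero => exact (le_or_gt j (s 0)).imp_right Or.inr
  | succ n ih =>
    rcases ih (fun i => s i.castSucc) with h | ⟨i, h⟩ | h
    · exact Or.inl h
    · exact Or.inr (Or.inl ⟨i.castSucc, h⟩)
    · rcases le_or_gt j (s (Fin.last (n + 1))) with h' | h'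
      · exact Or.inr (Or.inl ⟨Fin.last n, h, h'⟩)
      · exact Or.inr (Or.inr h')

section Rows

variable {n : ℕ} {s : Fin (n + 1) → ℤ} {s' : Fin n → ℤ} {j : ℤ}

theorem eq_of_between (hs : StrictMono s) {i i' : Fin n} (h1 : s i.castSucc < j)
    (h2 : j ≤ s i.succ) (h3 : s i'.castSucc < j) (h4 : j ≤ s i'.succ) : i = i' := by
  have h5 := hs.lt_iff_lt.1 (h1.trans_le h4)
  have h6 := hs.lt_iff_lt.1 (h3.trans_le h2)
  rw [Fin.lt_def] at h5 h6
  simp at h5 h6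
  omega

theorem pairedLeft_or (s : Fin (n + 1) → ℤ) (s' : Fin n → ℤ) (j : ℤ) :
    PairedLeft s s' j ∨ (∃ i, s' i = j) ∨ PairedRight s s' j := by
  rcases exists_between_or s j with h1 | ⟨i, h1, h2⟩ | h1
  · exact Or.inl (Or.inl h1)
  · rcases lt_trichotomy (s' i) j with h3 | h3 | h3
    · exact Or.inl (Or.inr ⟨i, h3, h2⟩)
    · exact Or.inr (Or.inl ⟨i, h3⟩)
    · exact Or.inr (Or.inr (Or.inr ⟨i, h1, h3⟩))
  · exact Or.inr (Or.inr (Or.inl h1))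

theorem not_pairedLeft_and_pairedRight (hs : StrictMono s) (h : Interlaces s s')
    (h1 : PairedLeft s s' j) (h2 : PairedRight s s' j) : False := by
  rcases h1 with h1 | ⟨i, h1, h1'⟩ <;> rcases h2 with h2 | ⟨i', h2, h2'⟩
  · have := hs.monotone (Fin.zero_le (Fin.last n))
    omega
  · have := hs.monotone (Fin.zero_le i'.castSucc)
    omega
  · have := hs.monotone (Fin.le_last i.succ)
    omega
  · obtain rfl := eq_of_between hs ((h i).1.trans h1) h1' h2 (h2'.le.trans (h i').2)
    omega

theorem not_pairedLeft_self (hs : StrictMono s) (h : Interlaces s s') (i : Fin n) :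
    ¬PairedLeft s s' (s' i) := by
  rintro (h1 | ⟨i', h1, h1'⟩)
  · have := hs.monotone (Fin.zero_le i.castSucc)
    have := h i
    omega
  · obtain rfl := eq_of_between hs ((h i').1.trans h1) h1' (h i).1 (h i).2
    omega

theorem not_pairedRight_self (hs : StrictMono s) (h : Interlaces s s') (i : Fin n) :
    ¬PairedRight s s' (s' i) := by
  rintro (h1 | ⟨i', h1, h1'⟩)
  · have := hs.monotone (Fin.le_last i.succ)
    have := h i
    omega
  · obtain rfl := eq_of_between hs h1 (h1'.le.trans (h i').2) (h i).1 (h i).2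
    omega

theorem not_pairedLeft_hole_add_one (hs : StrictMono s) (h : Interlaces s s') (i : Fin (n + 1)) :
    ¬PairedLeft s s' (s i + 1) := by
  rintro (h1 | ⟨i', h1, h1'⟩)
  · have := hs.monotone (Fin.zero_le i)
    omega
  · have h2 := (h i').1
    have h3 := hs.lt_iff_lt.1 (show s i < s i'.succ by omega)
    have h4 := hs.monotone (Fin.le_castSucc_iff.2 h3)
    have h5 := hs.le_iff_le.1 (show s i'.castSucc ≤ s i by omega)
    omega

theorem not_pairedRight_hole (hs : StrictMono s) (h : Interlaces s s') (i : Fin (n + 1)) :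
    ¬PairedRight s s' (s i) := by
  rintro (h1 | ⟨i', h1, h1'⟩)
  · have := hs.monotone (Fin.le_last i)
    omega
  · have h2 := (h i').2
    have h3 := hs.lt_iff_lt.1 (show s i < s i'.succ by omega)
    have h4 := hs.monotone (Fin.le_castSucc_iff.2 h3)
    omega

theorem not_pairedRight_and_pairedLeft_add_one (hs : StrictMono s) (h : Interlaces s s')
    (h1 : PairedRight s s' j) (h2 : PairedLeft s s' (j + 1)) : False := by
  rcases h2 with h2 | ⟨i, h2, h2'⟩ <;> rcases h1 with h1 | ⟨i', h1, h1'⟩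
  · have := hs.monotone (Fin.zero_le (Fin.last n))
    omega
  · have := hs.monotone (Fin.zero_le i'.castSucc)
    omega
  · have := hs.monotone (Fin.le_last i.succ)
    omega
  · have := (h i).1
    have := (h i').2
    obtain rfl := eq_of_between (j := j) hs (by omega : s i.castSucc < j) (by omega) h1 (by omega)
    omega

theorem pairedRight_or (s' : Fin n → ℤ) (hj : ∀ i, s i ≠ j) :
    PairedRight s s' j ∨ PairedLeft s s' (j + 1) := by
  rcases exists_between_or s j with h1 | ⟨i, h1, h2⟩ | h1
  · have := hj 0
    exact Or.inr (Or.inl (by omega))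
  · have := hj i.succ
    rcases le_or_gt (s' i) j with h3 | h3
    · exact Or.inr (Or.inr ⟨i, by omega, by omega⟩)
    · exact Or.inl (Or.inr ⟨i, h1, h3⟩)
  · exact Or.inl (Or.inl h1)

/-- A perfect pairing of the triangles in a row with holes `s` is given by a sequence
interlacing `s`. -/
theorem exists_interlaces_of_pairing {l r : ℤ} {lf cr rt : ℤ → Prop}
    (hs : StrictMono s) (hl : ∀ i, l ≤ s i) (hr : ∀ i, s i ≤ r)
    (hu : ∀ j, l < j → j ≤ r → lf j ∨ cr j ∨ rt j)
    (hlr : ∀ j, lf j → rt j → False)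
    (hlmem : ∀ j, lf j → j ≤ r) (hrmem : ∀ j, rt j → l < j)
    (hd : ∀ j, l ≤ j → j ≤ r → (∀ i, s i ≠ j) → rt j ∨ lf (j + 1))
    (hd' : ∀ j, rt j → lf (j + 1) → False)
    (hrs : ∀ i, ¬rt (s i)) (hls : ∀ i, ¬lf (s i + 1)) :
    ∃ s' : Fin n → ℤ, Interlaces s s' ∧ ∀ j, l < j → j ≤ r →
      (PairedLeft s s' j → lf j) ∧ ((∃ i, s' i = j) → cr j) ∧ (PairedRight s s' j → rt j) := by
  have hhole : ∀ (i : Fin n) j, s i.castSucc < j → j < s i.succ → ∀ i', s i' ≠ j := by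
    intro i j h1 h2 i' h3
    have h4 := hs.lt_iff_lt.1 (h1.trans_eq h3.symm)
    have h5 := hs.lt_iff_lt.1 (h3.trans_lt h2)
    rw [Fin.lt_def] at h4 h5
    simp at h4 h5
    omega
  have hmid : ∀ i : Fin n, ∃ m, (s i.castSucc < m ∧ m ≤ s i.succ) ∧ cr m ∧
      (∀ j, s i.castSucc < j → j < m → rt j) ∧ ∀ j, m < j → j ≤ s i.succ → lf j := by
    intro i
    have hi : s i.castSucc < s i.succ := hs Fin.castSucc_lt_succ
    obtain ⟨m, ⟨hm, hm'⟩, hmin⟩ := Int.exists_least_of_bdd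
      (P := fun j => s i.castSucc < j ∧ ¬rt j) ⟨_, fun z hz => hz.1.le⟩ ⟨_, hi, hrs _⟩
    have hms := hmin _ ⟨hi, hrs _⟩
    have hrt : ∀ j, s i.castSucc < j → j < m → rt j := by
      intro j h1 h2
      by_contra h3
      have := hmin _ ⟨h1, h3⟩
      omega
    have hnl : ¬lf m := by
      intro h
      rcases eq_or_lt_of_le (show s i.castSucc + 1 ≤ m by omega) with h1 | h1
      · exact hls i.castSucc (h1 ▸ h)
      · exact hd' (m - 1) (hrt _ (by omega) (by omega)) (by simpa using h)
    have hcr : cr m := by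
      have := hu m (by have := hl i.castSucc; omega) (by have := hr i.succ; omega)
      tauto
    refine ⟨m, ⟨hm, hms⟩, hcr, hrt, fun j hj => ?_⟩
    induction j, (show m + 1 ≤ j by omega) using Int.leInduction with
    | base =>
      intro h
      have := hl i.castSucc
      have := hr i.succ
      exact (hd m (by omega) (by omega) (hhole i m hm (by omega))).resolve_left hm'
    | succ j hj' ih =>
      intro h
      have := hl i.castSucc
      have := hr i.succ
      exact (hd j (by omega) (by omega) (hhole i j (by omega) (by omega))).resolve_left
        (hlr j (ih (by omega) (by omega)))
  choose s' h1 h2 h3 h4 using hmid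
  refine ⟨s', h1, fun j hj hj' => ⟨?_, ?_, ?_⟩⟩
  · rintro (h | ⟨i, h, h'⟩)
    · have hne : ∀ m, m < s 0 → ∀ i, s i ≠ m := fun m hm i hi => by
        have := hs.monotone (Fin.zero_le i)
        omega
      have := hr 0
      induction j, (show l + 1 ≤ j by omega) using Int.leInduction with
      | base =>
        refine (hd l le_rfl (by omega) (hne l (by omega))).resolve_left fun h => ?_
        have := hrmem _ h
        omega
      | succ j hj'' ih =>
        exact (hd j (by omega) (by omega) (hne j (by omega))).resolve_left
          (hlr j (ih (by omega) (by omega) (by omega)))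
    · exact h4 i j h h'
  · rintro ⟨i, rfl⟩
    exact h2 i
  · rintro (h | ⟨i, h, h'⟩)
    · have hne : ∀ m, s (Fin.last n) < m → ∀ i, s i ≠ m := fun m hm i hi => by
        have := hs.monotone (Fin.le_last i)
        omega
      have := hl (Fin.last n)
      obtain ⟨k, hk⟩ := Int.eq_ofNat_of_zero_le (show 0 ≤ r - j by omega)
      induction k generalizing j with
      | zero =>
        refine (hd j hj.le hj' (hne j h)).resolve_right fun h => ?_
        have := hlmem _ h
        omega
      | succ k ih =>
        exact (hd j hj.le hj' (hne j h)).resolve_right fun h' =>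
          hlr _ h' (ih (j + 1) (by omega) (by omega) (by omega) (by omega))
    · exact h3 i j h h'

end Rows

/-- The rows `d, …, T - 1` of triangles (counted by `x + y`) with `x ≤ X` and `y ≤ Y`, with the
down-pointing triangles at heights `s i` removed from row `d`. -/
def trapezoid (X Y d T : ℤ) {n : ℕ} (s : Fin n → ℤ) : Set Tri :=
  {t | t.1 ≤ X ∧ t.2.1 ≤ Y ∧ if t.2.2 then d ≤ t.1 + t.2.1 ∧ t.1 + t.2.1 < T
    else d ≤ t.1 + t.2.1 + 1 ∧ t.1 + t.2.1 + 1 < T ∧ (t.1 + t.2.1 + 1 = d → ∀ i, s i ≠ t.2.1)}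

/-- The lozenges covering row `d` of a trapezoid, with holes `s` below and particles `s'` above. -/
def rowLozenges (X Y d : ℤ) {n : ℕ} (s : Fin (n + 1) → ℤ) (s' : Fin n → ℤ) : Set (Set Tri) :=
  {L | ∃ j, d - X ≤ j ∧ j ≤ Y ∧ (PairedLeft s s' j ∧ L = loz (d - j) j (d - j) (j - 1) ∨
    (∃ i, s' i = j) ∧ L = loz (d - j) j (d - j) j ∨
    PairedRight s s' j ∧ L = loz (d - j) j (d - j - 1) j)}

section Trapezoid

variable {X Y d T : ℤ} {n : ℕ}

theorem up_mem_trapezoid {s : Fin n → ℤ} {x y : ℤ} :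
    ((x, y, true) : Tri) ∈ trapezoid X Y d T s ↔ x ≤ X ∧ y ≤ Y ∧ d ≤ x + y ∧ x + y < T := by
  simp [trapezoid]

theorem down_mem_trapezoid {s : Fin n → ℤ} {x y : ℤ} :
    ((x, y, false) : Tri) ∈ trapezoid X Y d T s ↔ x ≤ X ∧ y ≤ Y ∧ d ≤ x + y + 1 ∧ x + y + 1 < T ∧
      (x + y + 1 = d → ∀ i, s i ≠ y) := by
  simp [trapezoid]

variable {s : Fin (n + 1) → ℤ} {s' : Fin n → ℤ}

theorem isLozengeTiling_rowLozenges (hs : StrictMono s) (h : Interlaces s s') :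
    IsLozengeTiling (⋃₀ rowLozenges X Y d s s') (rowLozenges X Y d s s') := by
  apply isLozengeTiling_sUnion
  · rintro L ⟨j, -, -, ⟨-, rfl⟩ | ⟨-, rfl⟩ | ⟨-, rfl⟩⟩
    exacts [⟨_, _, Or.inr (Or.inr rfl)⟩, ⟨_, _, Or.inl rfl⟩, ⟨_, _, Or.inr (Or.inl rfl)⟩]
  · rintro L ⟨j, -, -, hL⟩ L' ⟨j', -, -, hL'⟩ ⟨x, y, ε⟩ ht ht'
    suffices hj : j = j' by
      subst hj
      rcases hL with ⟨h1, rfl⟩ | ⟨⟨i, rfl⟩, rfl⟩ | ⟨h1, rfl⟩ <;>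
        rcases hL' with ⟨h2, rfl⟩ | ⟨⟨i', h2⟩, rfl⟩ | ⟨h2, rfl⟩ <;> try rfl
      · exact absurd (h2 ▸ h1) (not_pairedLeft_self hs h i')
      · exact (not_pairedLeft_and_pairedRight hs h h1 h2).elim
      · exact absurd h2 (not_pairedLeft_self hs h i)
      · exact absurd h2 (not_pairedRight_self hs h i)
      · exact (not_pairedLeft_and_pairedRight hs h h2 h1).elim
      · exact absurd (h2 ▸ h1) (not_pairedRight_self hs h i')
    cases ε
    · rcases hL with ⟨h1, rfl⟩ | ⟨h1, rfl⟩ | ⟨h1, rfl⟩ <;>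
        rcases hL' with ⟨h2, rfl⟩ | ⟨h2, rfl⟩ | ⟨h2, rfl⟩ <;>
        rw [down_mem_loz] at ht ht' <;> try omega
      · obtain rfl : j = j' + 1 := by omega
        exact (not_pairedRight_and_pairedLeft_add_one hs h h2 h1).elim
      · obtain rfl : j' = j + 1 := by omega
        exact (not_pairedRight_and_pairedLeft_add_one hs h h1 h2).elim
    · rcases hL with ⟨h1, rfl⟩ | ⟨h1, rfl⟩ | ⟨h1, rfl⟩ <;>
        rcases hL' with ⟨h2, rfl⟩ | ⟨h2, rfl⟩ | ⟨h2, rfl⟩ <;>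
        rw [up_mem_loz] at ht ht' <;> omega

theorem up_mem_sUnion_rowLozenges {x y : ℤ} :
    ((x, y, true) : Tri) ∈ ⋃₀ rowLozenges X Y d s s' ↔ x ≤ X ∧ y ≤ Y ∧ x + y = d := by
  constructor
  · rintro ⟨L, ⟨j, hj, hj', ⟨-, rfl⟩ | ⟨-, rfl⟩ | ⟨-, rfl⟩⟩, ht⟩ <;> rw [up_mem_loz] at ht <;> omega
  · rintro ⟨hx, hy, rfl⟩
    rcases pairedLeft_or s s' y with h | h | h
    · exact ⟨_, ⟨y, by omega, hy, Or.inl ⟨h, rfl⟩⟩, up_mem_loz.2 (by omega)⟩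
    · exact ⟨_, ⟨y, by omega, hy, Or.inr (Or.inl ⟨h, rfl⟩)⟩, up_mem_loz.2 (by omega)⟩
    · exact ⟨_, ⟨y, by omega, hy, Or.inr (Or.inr ⟨h, rfl⟩)⟩, up_mem_loz.2 (by omega)⟩

theorem down_mem_sUnion_rowLozenges (hs : StrictMono s) (h : Interlaces s s')
    (hl : ∀ i, d - 1 - X ≤ s i) (hr : ∀ i, s i ≤ Y) {x y : ℤ} :
    ((x, y, false) : Tri) ∈ ⋃₀ rowLozenges X Y d s s' ↔
      x ≤ X ∧ y ≤ Y ∧ x + y + 1 = d ∧ (∀ i, s i ≠ y) ∨ x + y = d ∧ ∃ i, s' i = y := by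
  constructor
  · rintro ⟨L, ⟨j, hj, hj', ⟨h1, rfl⟩ | ⟨h1, rfl⟩ | ⟨h1, rfl⟩⟩, ht⟩ <;> rw [down_mem_loz] at ht <;>
      obtain ⟨rfl, rfl⟩ := ht
    · refine Or.inl ⟨by omega, by omega, by omega, fun i hi => ?_⟩
      exact not_pairedLeft_hole_add_one hs h i (by rwa [hi, sub_add_cancel])
    · exact Or.inr ⟨by omega, h1⟩
    · refine Or.inl ⟨by omega, by omega, by omega, fun i hi => ?_⟩
      exact not_pairedRight_hole hs h i (by rwa [hi])
  · rintro (⟨hx, hy, hd, hn⟩ | ⟨hd, i, hi⟩)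
    · rcases pairedRight_or s' hn with h1 | h1
      · refine ⟨_, ⟨y, ?_, hy, Or.inr (Or.inr ⟨h1, rfl⟩)⟩, down_mem_loz.2 (by omega)⟩
        by_contra h2
        rcases h1 with h1 | ⟨i, h1, -⟩
        · have := hl (Fin.last n)
          omega
        · have := hl i.castSucc
          omega
      · refine ⟨_, ⟨y + 1, by omega, ?_, Or.inl ⟨h1, rfl⟩⟩, down_mem_loz.2 (by omega)⟩
        rcases h1 with h1 | ⟨i, -, h1⟩
        · have := hr 0
          omega
        · have := hr i.succ
          omega
    · have := h i
      have := hl i.castSucc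
      have := hr i.succ
      exact ⟨_, ⟨y, by omega, by omega, Or.inr (Or.inl ⟨⟨i, hi⟩, rfl⟩)⟩, down_mem_loz.2 (by omega)⟩

theorem sUnion_rowLozenges_subset (hs : StrictMono s) (h : Interlaces s s')
    (hl : ∀ i, d - 1 - X ≤ s i) (hr : ∀ i, s i ≤ Y) (hdT : d + n + 1 = T) :
    ⋃₀ rowLozenges X Y d s s' ⊆ trapezoid X Y d T s := by
  rintro ⟨x, y, ε⟩ ht
  cases ε
  · rw [down_mem_sUnion_rowLozenges hs h hl hr] at ht
    rw [down_mem_trapezoid]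
    rcases ht with ht | ⟨ht, i, hi⟩
    · exact ⟨ht.1, ht.2.1, by omega, by omega, fun _ => ht.2.2.2⟩
    · have := h i
      have := hl i.castSucc
      have := hr i.succ
      have := i.2
      exact ⟨by omega, by omega, by omega, by omega, by omega⟩
  · rw [up_mem_sUnion_rowLozenges] at ht
    rw [up_mem_trapezoid]
    omega

theorem trapezoid_diff_rowLozenges (hs : StrictMono s) (h : Interlaces s s')
    (hl : ∀ i, d - 1 - X ≤ s i) (hr : ∀ i, s i ≤ Y) :
    trapezoid X Y d T s \ ⋃₀ rowLozenges X Y d s s' = trapezoid X Y (d + 1) T s' := by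
  ext ⟨x, y, ε⟩
  cases ε
  · rw [Set.mem_sdiff, down_mem_sUnion_rowLozenges hs h hl hr, down_mem_trapezoid,
      down_mem_trapezoid]
    constructor
    · rintro ⟨⟨h1, h2, h3, h4, h5⟩, h6⟩
      have h7 : x + y + 1 ≠ d := fun h7 => h6 (Or.inl ⟨h1, h2, h7, h5 h7⟩)
      exact ⟨h1, h2, by omega, h4, fun h8 i hi => h6 (Or.inr ⟨by omega, i, hi⟩)⟩
    · rintro ⟨h1, h2, h3, h4, h5⟩
      refine ⟨⟨h1, h2, by omega, h4, by omega⟩, ?_⟩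
      rintro (h6 | ⟨h6, i, hi⟩)
      · omega
      · exact h5 (by omega) i hi
  · rw [Set.mem_sdiff, up_mem_sUnion_rowLozenges, up_mem_trapezoid, up_mem_trapezoid]
    omega

theorem exists_interlaces_rowLozenges_subset (hs : StrictMono s) (hl : ∀ i, d - 1 - X ≤ s i)
    (hr : ∀ i, s i ≤ Y) (hdT : d + n + 1 = T) {P : Set (Set Tri)}
    (hP : IsLozengeTiling (trapezoid X Y d T s) P) :
    ∃ s' : Fin n → ℤ, Interlaces s s' ∧ rowLozenges X Y d s s' ⊆ P := by
  obtain ⟨s', h, hj⟩ := exists_interlaces_of_pairing (l := d - 1 - X) (r := Y)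
    (lf := fun j => loz (d - j) j (d - j) (j - 1) ∈ P) (cr := fun j => loz (d - j) j (d - j) j ∈ P)
    (rt := fun j => loz (d - j) j (d - j - 1) j ∈ P) hs hl hr
    (fun j h1 h2 => by
      have := hP.cases_up (x := d - j) (y := j) (up_mem_trapezoid.2 (by omega))
      tauto)
    (fun j h1 h2 => by
      have := hP.down_unique h1 h2 rfl rfl
      omega)
    (fun j h1 => (up_mem_trapezoid.1 (hP.up_mem h1)).2.1)
    (fun j h1 => by
      have := (up_mem_trapezoid.1 (hP.up_mem h1)).1
      omega)
    (fun j h1 h2 h3 => by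
      rcases hP.cases_down (x := d - 1 - j) (y := j) (down_mem_trapezoid.2
        ⟨by omega, by omega, by omega, by omega, fun _ => h3⟩) with h4 | h4 | h4
      · have := up_mem_trapezoid.1 (hP.up_mem h4)
        omega
      · left
        convert h4 using 1
        exact loz_congr (by omega) (by omega) (by omega) (by omega)
      · right
        convert h4 using 1
        exact loz_congr (by omega) (by omega) (by omega) (by omega))
    (fun j h1 h2 => by
      have := hP.up_unique h1 h2 (by omega) (by omega)
      omega)
    (fun i h1 => by
      have := (down_mem_trapezoid.1 (hP.down_mem h1)).2.2.2.2 (by omega) i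
      omega)
    (fun i h1 => by
      have := (down_mem_trapezoid.1 (hP.down_mem h1)).2.2.2.2 (by omega) i
      omega)
  refine ⟨s', h, ?_⟩
  rintro L ⟨j, h1, h2, ⟨h3, rfl⟩ | ⟨h3, rfl⟩ | ⟨h3, rfl⟩⟩
  · exact (hj j (by omega) h2).1 h3
  · exact (hj j (by omega) h2).2.1 h3
  · exact (hj j (by omega) h2).2.2 h3

theorem interlaces_eq_of_rowLozenges_subset {s'' : Fin n → ℤ} (hl : ∀ i, d - 1 - X ≤ s i)
    (hr : ∀ i, s i ≤ Y) {R : Set Tri} {P : Set (Set Tri)} (hP : IsLozengeTiling R P)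
    (h' : Interlaces s s') (h'' : Interlaces s s'') (hF' : rowLozenges X Y d s s' ⊆ P)
    (hF'' : rowLozenges X Y d s s'' ⊆ P) : s' = s'' := by
  have key : ∀ {u v : Fin n → ℤ}, Interlaces s u → Interlaces s v → rowLozenges X Y d s u ⊆ P →
      rowLozenges X Y d s v ⊆ P → ∀ i, ¬u i < v i := by
    intro u v hu hv hFu hFv i hlt
    have h1 := hu i
    have h2 := hv i
    have h3 := hl i.castSucc
    have h4 := hr i.succ
    have h5 := hFu ⟨v i, by omega, by omega, Or.inl ⟨Or.inr ⟨i, hlt, h2.2⟩, rfl⟩⟩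
    have h6 := hFv ⟨v i, by omega, by omega, Or.inr (Or.inl ⟨⟨i, rfl⟩, rfl⟩)⟩
    have := hP.down_unique h5 h6 rfl rfl
    omega
  ext i
  have h1 := key h' h'' hF' hF'' i
  have h2 := key h'' h' hF'' hF' i
  omega

end Trapezoid

theorem isLozengeTiling_empty_iff {P : Set (Set Tri)} : IsLozengeTiling ∅ P ↔ P = ∅ := by
  constructor
  · intro h
    refine Set.eq_empty_of_forall_notMem fun L hL => ?_
    obtain ⟨t, ht⟩ := (h.isLoz hL).nonempty
    exact h.2.1 L hL ht
  · rintro rfl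
    exact ⟨by simp, by simp, by simp⟩

/-- The tilings of a trapezoid, sorted by the sequence of particles leaving the bottom row. -/
noncomputable def trapezoidTilingsEquiv {X Y d T : ℤ} {n : ℕ} {s : Fin (n + 1) → ℤ}
    (hs : StrictMono s) (hl : ∀ i, d - 1 - X ≤ s i) (hr : ∀ i, s i ≤ Y) (hdT : d + n + 1 = T) :
    (Σ s' : {s' // Interlaces s s'}, {Q // IsLozengeTiling (trapezoid X Y (d + 1) T s'.1) Q}) ≃
      {P // IsLozengeTiling (trapezoid X Y d T s) P} :=
  (Equiv.sigmaCongrRight fun s' => (Equiv.subtypeEquivRight fun Q => by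
      rw [trapezoid_diff_rowLozenges hs s'.2 hl hr]).trans
    (tilingsContainingEquiv (isLozengeTiling_rowLozenges hs s'.2)
      (sUnion_rowLozenges_subset hs s'.2 hl hr hdT)).symm).trans <|
  Equiv.ofBijective (fun p => ⟨p.2.1, p.2.2.1⟩) <| by
    constructor
    · rintro ⟨⟨s', h'⟩, P, hP, hF'⟩ ⟨⟨s'', h''⟩, Q, hQ, hF''⟩ hPQ
      obtain rfl : P = Q := congrArg Subtype.val hPQ
      obtain rfl := interlaces_eq_of_rowLozenges_subset hl hr hP h' h'' hF' hF''
      rfl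
    · rintro ⟨P, hP⟩
      obtain ⟨s', h', hF⟩ := exists_interlaces_rowLozenges_subset hs hl hr hdT hP
      exact ⟨⟨⟨s', h'⟩, P, hP, hF⟩, rfl⟩

theorem Interlaces.strictMono {n : ℕ} {s : Fin (n + 1) → ℤ} {s' : Fin n → ℤ} (hs : StrictMono s)
    (h : Interlaces s s') : StrictMono s' := by
  intro i j hij
  have h1 := hs.monotone (Fin.le_castSucc_iff.2 (Fin.succ_lt_succ_iff.2 hij))
  have := h i
  have := h j
  omega

theorem finite_tilings_and_M_trapezoid {X Y T : ℤ} {n : ℕ} : ∀ {d : ℤ} (s : Fin n → ℤ),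
    StrictMono s → (∀ i, d - 1 - X ≤ s i) → (∀ i, s i ≤ Y) → d + n = T →
    Finite {P // IsLozengeTiling (trapezoid X Y d T s) P} ∧ (M (trapezoid X Y d T s) : ℤ) =
      (Matrix.of fun i j : Fin n => Ring.choose (s i + (n : ℤ)) (j : ℕ)).det := by
  induction n with
  | zero =>
    intro d s _ _ _ hdT
    have h : trapezoid X Y d T s = ∅ := by
      refine Set.eq_empty_of_forall_notMem ?_
      rintro ⟨x, y, ε⟩ ht
      cases ε
      · have := down_mem_trapezoid.1 ht
        omega
      · have := up_mem_trapezoid.1 ht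
        omega
    simp only [M, h, isLozengeTiling_empty_iff]
    exact ⟨inferInstance, by simp⟩
  | succ n ih =>
    intro d s hs hl hr hdT
    let I : Finset (Fin n → ℤ) :=
      Fintype.piFinset fun i : Fin n => Finset.Ioc (s i.castSucc) (s i.succ)
    have hI : ∀ s', s' ∈ I ↔ Interlaces s s' := fun s' => by
      simp [I, Interlaces]
    let e := trapezoidTilingsEquiv hs hl hr (by push_cast at hdT; omega : d + n + 1 = T)
    have : Fintype {s' // Interlaces s s'} := Fintype.subtype I hI
    have ih' : ∀ s' : {s' // Interlaces s s'}, _ := fun s' =>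
      ih (d := d + 1) s'.1 (s'.2.strictMono hs)
        (fun i => by have := s'.2 i; have := hl i.castSucc; omega)
        (fun i => by have := s'.2 i; have := hr i.succ; omega) (by push_cast at hdT; omega)
    have := fun s' => (ih' s').1
    refine ⟨Finite.of_equiv _ e, ?_⟩
    rw [M, ← Nat.card_congr e, Nat.card_sigma, Nat.cast_sum,
      ← sum_interlacing_det_choose s fun i => (hs Fin.castSucc_lt_succ).le,
      Finset.sum_subtype I hI fun s' =>
        (Matrix.of fun i j : Fin n => Ring.choose (s' i + (n : ℤ)) (j : ℕ)).det]
    exact Finset.sum_congr rfl fun s' _ => (ih' s').2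

section Hexagon

variable (a b c : ℕ)

/-- The trapezoid obtained from the hexagon `Hex a b c` by gluing on two triangular regions. -/
def hexTrapezoid : Set Tri :=
  trapezoid (a + b - 1) (b + c - 1) b (a + b + c) (splitPos a b c)

/-- The lozenges of `hexTrapezoid a b c` outside of the hexagon. -/
def cornerLozenges : Set (Set Tri) :=
  {L | ∃ x y : ℤ, (x < 0 ∨ y < 0) ∧ ((x, y, true) : Tri) ∈ hexTrapezoid a b c ∧ L = loz x y x y}

variable {a b c}

theorem up_mem_hexTrapezoid {x y : ℤ} : ((x, y, true) : Tri) ∈ hexTrapezoid a b c ↔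
    x ≤ a + b - 1 ∧ y ≤ b + c - 1 ∧ b ≤ x + y ∧ x + y < a + b + c :=
  up_mem_trapezoid

theorem down_mem_hexTrapezoid {x y : ℤ} : ((x, y, false) : Tri) ∈ hexTrapezoid a b c ↔
    x ≤ a + b - 1 ∧ y ≤ b + c - 1 ∧ b ≤ x + y + 1 ∧ x + y + 1 < a + b + c ∧
      (x + y + 1 = b → 0 ≤ x ∧ 0 ≤ y) := by
  have h := exists_splitPos_eq_iff (a := a) (b := b) (c := c) (y := y)
  rw [hexTrapezoid, down_mem_trapezoid, ← not_exists, h]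
  omega

theorem isLozengeTiling_cornerLozenges :
    IsLozengeTiling (⋃₀ cornerLozenges a b c) (cornerLozenges a b c) := by
  apply isLozengeTiling_sUnion
  · rintro L ⟨x, y, -, -, rfl⟩
    exact ⟨x, y, Or.inl rfl⟩
  · rintro L ⟨x, y, -, -, rfl⟩ L' ⟨x', y', -, -, rfl⟩ ⟨u, v, ε⟩ ht ht'
    cases ε
    · rw [down_mem_loz] at ht ht'
      exact loz_congr (by omega) (by omega) (by omega) (by omega)
    · rw [up_mem_loz] at ht ht'
      exact loz_congr (by omega) (by omega) (by omega) (by omega)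

theorem up_mem_sUnion_cornerLozenges {x y : ℤ} :
    ((x, y, true) : Tri) ∈ ⋃₀ cornerLozenges a b c ↔
      (x < 0 ∨ y < 0) ∧ ((x, y, true) : Tri) ∈ hexTrapezoid a b c := by
  constructor
  · rintro ⟨L, ⟨u, v, h, h', rfl⟩, ht⟩
    obtain ⟨rfl, rfl⟩ := up_mem_loz.1 ht
    exact ⟨h, h'⟩
  · rintro ⟨h, h'⟩
    exact ⟨_, ⟨x, y, h, h', rfl⟩, up_mem_loz.2 ⟨rfl, rfl⟩⟩

theorem down_mem_sUnion_cornerLozenges {x y : ℤ} :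
    ((x, y, false) : Tri) ∈ ⋃₀ cornerLozenges a b c ↔
      (x < 0 ∨ y < 0) ∧ ((x, y, true) : Tri) ∈ hexTrapezoid a b c := by
  constructor
  · rintro ⟨L, ⟨u, v, h, h', rfl⟩, ht⟩
    obtain ⟨rfl, rfl⟩ := down_mem_loz.1 ht
    exact ⟨h, h'⟩
  · rintro ⟨h, h'⟩
    exact ⟨_, ⟨x, y, h, h', rfl⟩, down_mem_loz.2 ⟨rfl, rfl⟩⟩

theorem sUnion_cornerLozenges_subset : ⋃₀ cornerLozenges a b c ⊆ hexTrapezoid a b c := by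
  rintro ⟨x, y, ε⟩ ht
  cases ε
  · rw [down_mem_sUnion_cornerLozenges, up_mem_hexTrapezoid] at ht
    rw [down_mem_hexTrapezoid]
    omega
  · exact (up_mem_sUnion_cornerLozenges.1 ht).2

theorem hexTrapezoid_diff_cornerLozenges :
    hexTrapezoid a b c \ ⋃₀ cornerLozenges a b c = Hex a b c := by
  ext ⟨x, y, ε⟩
  cases ε
  · rw [Set.mem_sdiff, down_mem_sUnion_cornerLozenges, down_mem_hexTrapezoid, up_mem_hexTrapezoid]
    simp [Hex, HexK]
    omega
  · rw [Set.mem_sdiff, up_mem_sUnion_cornerLozenges, up_mem_hexTrapezoid]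
    simp [Hex, HexK]
    omega

theorem cornerLozenges_subset {P : Set (Set Tri)} (hP : IsLozengeTiling (hexTrapezoid a b c) P) :
    cornerLozenges a b c ⊆ P := by
  have key : ∀ m : ℕ, ∀ x y : ℤ, x + y = b + m → (x < 0 ∨ y < 0) →
      ((x, y, true) : Tri) ∈ hexTrapezoid a b c → loz x y x y ∈ P := by
    intro m
    induction m with
    | zero =>
      intro x y hxy hneg hR
      have h1 := up_mem_hexTrapezoid.1 hR
      rcases hP.cases_up hR with h | h | h
      · exact h
      · have := down_mem_hexTrapezoid.1 (hP.down_mem h)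
        omega
      · have := down_mem_hexTrapezoid.1 (hP.down_mem h)
        omega
    | succ m ih =>
      intro x y hxy hneg hR
      have h1 := up_mem_hexTrapezoid.1 hR
      rcases hP.cases_up hR with h | h | h
      · exact h
      · have := hP.up_unique h (ih (x - 1) y (by push_cast at hxy; omega) (by omega)
          (up_mem_hexTrapezoid.2 (by omega))) rfl rfl
        omega
      · have := hP.up_unique h (ih x (y - 1) (by push_cast at hxy; omega) (by omega)
          (up_mem_hexTrapezoid.2 (by omega))) rfl rfl
        omega
  rintro L ⟨x, y, hneg, hR, rfl⟩
  have := up_mem_hexTrapezoid.1 hR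
  exact key (x + y - b).toNat x y (by omega) hneg hR

/-- MacMahon's formula for the number of lozenge tilings of a hexagon. -/
theorem M_hex (a b c : ℕ) : (M (Hex a b c) : ℚ) =
    ∏ i ∈ Finset.Icc 1 a, ∏ j ∈ Finset.Icc 1 b, ∏ l ∈ Finset.Icc 1 c,
      ((i : ℚ) + j + l - 1) / ((i : ℚ) + j + l - 2) := by
  rw [← det_choose_splitPos a b c ((a + c : ℕ) : ℤ), ← hexTrapezoid_diff_cornerLozenges,
    ← M_eq_M_diff_of_forced isLozengeTiling_cornerLozenges sUnion_cornerLozenges_subset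
      fun _ hP => cornerLozenges_subset hP]
  have hmem : ∀ i, -(a : ℤ) ≤ splitPos a b c i ∧ splitPos a b c i ≤ b + c - 1 := fun i => by
    have := exists_splitPos_eq_iff.1 ⟨i, (rfl : splitPos a b c i = _)⟩
    omega
  have h := (finite_tilings_and_M_trapezoid (X := a + b - 1) (Y := b + c - 1) (T := a + b + c)
    (d := b) (splitPos a b c) (strictMono_splitPos a b c) (fun i => by have := hmem i; omega)
    (fun i => (hmem i).2) (by push_cast; ring)).2
  rw [← h]
  simp [hexTrapezoid]

end Hexagon

/-- In every lozenge tiling of `H̄^k_{a,b,c}` the lozenges of the `k` strips along the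
southwestern side are forced, and consequently `M(H̄^k_{a,b,c})` equals the number of
lozenge tilings of the hexagon with side lengths `a, b+k, c, a, b+k, c`, i.e.
`∏_{i=1}^a ∏_{j=1}^{b+k} ∏_{l=1}^c (i+j+l-1)/(i+j+l-2)`. -/
theorem hexbar_forced_strips_and_count (a b c k : ℕ) :
    (∀ P, IsLozengeTiling (HexBar a b c k) P → ForcedStrips a b c k ⊆ P) ∧
    (M (HexBar a b c k) : ℚ) =
      ∏ i ∈ Finset.Icc 1 a, ∏ j ∈ Finset.Icc 1 (b + k), ∏ l ∈ Finset.Icc 1 c,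
        ((i : ℚ) + j + l - 1) / ((i : ℚ) + j + l - 2) := by
  refine ⟨fun P hP => forcedStrips_subset hP, ?_⟩
  rw [M_hexBar, M_hex]
end
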